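/- arXiv:2004.03382 — 5 statements merged into one kernel-verified Lean document; each statement's English description precedes it below -/
import Mathlib

section
/- Let N ∈ ℕ, let c_1,…,c_N ∈ ℝ be distinct points, and let a_1,…,a_N > 0. Define Hν(x) := (1/π) Σ_{k=1}^N a_k/(x − c_k) for x ∉ {c_1,…,c_N}. Then for every λ > 0, the Lebesgue measure of {x ∈ ℝ : |Hν(x)| > λ} equals (2/(πλ)) Σ_{k=1}^N a_k. -/
open MeasureTheory Set

/-- The sum `∑ₖ aₖ/(x - cₖ)` does not increase along an interval containing no pole. -/
lemma sum_div_sub_le_of_no_pole {ι : Type*} [Fintype ι] {a c : ι → ℝ} (ha : ∀ k, 0 < a k)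
    {x y : ℝ} (hxy : x ≤ y) (h : ∀ k, c k < x ∨ y < c k) :
    ∑ k, a k / (y - c k) ≤ ∑ k, a k / (x - c k) := by
  refine Finset.sum_le_sum fun k _ => ?_
  rcases h k with hk | hk
  · exact div_le_div_of_nonneg_left (ha k).le (by linarith) (by linarith)
  · rw [← neg_sub (c k) y, ← neg_sub (c k) x, div_neg, div_neg, neg_le_neg_iff]
    exact div_le_div_of_nonneg_left (ha k).le (by linarith) (by linarith)

/-- The sum `∑ₖ aₖ/(x - cₖ)` strictly decreases along an interval containing no pole. -/
lemma sum_div_sub_lt_of_no_pole {ι : Type*} [Fintype ι] [Nonempty ι] {a c : ι → ℝ}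
    (ha : ∀ k, 0 < a k) {x y : ℝ} (hxy : x < y) (h : ∀ k, c k < x ∨ y < c k) :
    ∑ k, a k / (y - c k) < ∑ k, a k / (x - c k) := by
  refine Finset.sum_lt_sum_of_nonempty Finset.univ_nonempty fun k _ => ?_
  rcases h k with hk | hk
  · exact div_lt_div_of_pos_left (ha k) (by linarith) (by linarith)
  · rw [← neg_sub (c k) y, ← neg_sub (c k) x, div_neg, div_neg, neg_lt_neg_iff]
    exact div_lt_div_of_pos_left (ha k) (by linarith) (by linarith)

lemma continuousAt_sum_div_sub {ι : Type*} (s : Finset ι) (a : ι → ℝ) {c : ι → ℝ} {x : ℝ}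
    (h : ∀ k ∈ s, x ≠ c k) : ContinuousAt (fun x => ∑ k ∈ s, a k / (x - c k)) x := by
  refine tendsto_finsetSum s fun k hk => ?_
  exact (continuousAt_const.div (continuousAt_id.sub continuousAt_const)
    (sub_ne_zero.2 (h k hk)))

lemma tendsto_sum_div_sub_nhdsGT {ι : Type*} [Fintype ι] {a c : ι → ℝ} (ha : ∀ k, 0 < a k)
    (hc : Function.Injective c) (k : ι) :
    Filter.Tendsto (fun x => ∑ j, a j / (x - c j)) (nhdsWithin (c k) (Ioi (c k)))
      Filter.atTop := by
  classical
  have hrest := (continuousAt_sum_div_sub (Finset.univ.erase k) a (c := c) (x := c k)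
    fun j hj => hc.ne (Finset.ne_of_mem_erase hj).symm).tendsto.mono_left
      (nhdsWithin_le_nhds (s := Ioi (c k)))
  have hsub : Filter.Tendsto (fun x => x - c k) (nhdsWithin (c k) (Ioi (c k)))
      (nhdsWithin 0 (Ioi 0)) := by
    refine tendsto_nhdsWithin_iff.2 ⟨?_, ?_⟩
    · exact (Continuous.tendsto' (by fun_prop : Continuous fun x => x - c k) _ _
        (sub_self _)).mono_left nhdsWithin_le_nhds
    · filter_upwards [self_mem_nhdsWithin] with x hx using sub_pos.2 (mem_Ioi.1 hx)
  have hpole := (tendsto_inv_nhdsGT_zero.comp hsub).const_mul_atTop (ha k)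
  refine (hpole.atTop_add hrest).congr fun x => ?_
  rw [← Finset.add_sum_erase _ _ (Finset.mem_univ k)]
  simp [div_eq_mul_inv]

lemma tendsto_sum_div_sub_nhdsLT {ι : Type*} [Fintype ι] {a c : ι → ℝ} (ha : ∀ k, 0 < a k)
    (hc : Function.Injective c) (k : ι) :
    Filter.Tendsto (fun x => ∑ j, a j / (x - c j)) (nhdsWithin (c k) (Iio (c k)))
      Filter.atBot := by
  have h := tendsto_sum_div_sub_nhdsGT (c := fun j => -c j) ha (neg_injective.comp hc) k
  refine (Filter.tendsto_neg_atTop_atBot.comp (h.comp tendsto_neg_nhdsLT)).congr fun x => ?_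
  simp only [Function.comp, ← Finset.sum_neg_distrib]
  refine Finset.sum_congr rfl fun j _ => ?_
  rw [← div_neg]
  ring_nf

lemma tendsto_sum_div_sub_atTop {ι : Type*} [Fintype ι] (a c : ι → ℝ) :
    Filter.Tendsto (fun x => ∑ j, a j / (x - c j)) Filter.atTop (nhds 0) := by
  rw [← Finset.sum_const_zero (s := (Finset.univ : Finset ι))]
  refine tendsto_finsetSum _ fun j _ => ?_
  exact Filter.Tendsto.const_div_atTop
    (Filter.tendsto_atTop_add_const_right _ (-c j) Filter.tendsto_id) _

/-- To the right of each pole, and before the next one, the sum takes every positive value. -/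
lemma exists_sum_div_sub_eq {ι : Type*} [Fintype ι] {a c : ι → ℝ} (ha : ∀ k, 0 < a k)
    (hc : Function.Injective c) {t : ℝ} (ht : 0 < t) (k : ι) :
    ∃ r, c k < r ∧ ∑ j, a j / (r - c j) = t ∧ ∀ j, c j ≤ c k ∨ r < c j := by
  obtain ⟨y, hky, hy, hsep⟩ : ∃ y, c k < y ∧ ∑ j, a j / (y - c j) < t ∧
      ∀ j, c j ≤ c k ∨ y < c j := by
    rcases (Finset.univ.filter fun j => c k < c j).eq_empty_or_nonempty with he | hne
    · obtain ⟨y, hy, hky⟩ := (((tendsto_sum_div_sub_atTop a c).eventually_lt_const ht).and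
        (Filter.eventually_gt_atTop (c k))).exists
      refine ⟨y, hky, hy, fun j => Or.inl (not_lt.1 fun hj => ?_)⟩
      exact Finset.notMem_empty j (he ▸ Finset.mem_filter.2 ⟨Finset.mem_univ j, hj⟩)
    · obtain ⟨m, hm, hmin⟩ := Finset.exists_min_image _ c hne
      have hkm : c k < c m := (Finset.mem_filter.1 hm).2
      obtain ⟨y, hy, hky⟩ := (((tendsto_sum_div_sub_nhdsLT ha hc m).eventually_lt_atBot t).and
        (Ioo_mem_nhdsLT hkm)).exists
      refine ⟨y, hky.1, hy, fun j => ?_⟩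
      rcases le_or_gt (c j) (c k) with hj | hj
      · exact Or.inl hj
      · exact Or.inr (hky.2.trans_le (hmin j (Finset.mem_filter.2 ⟨Finset.mem_univ j, hj⟩)))
  obtain ⟨x, hx, hkx⟩ := (((tendsto_sum_div_sub_nhdsGT ha hc k).eventually_gt_atTop t).and
    (Ioo_mem_nhdsGT hky)).exists
  have hcont : ContinuousOn (fun x => ∑ j, a j / (x - c j)) (Icc x y) := fun z hz =>
    (continuousAt_sum_div_sub _ a fun j _ => by
      rcases hsep j with hj | hj
      · exact (hj.trans_lt (hkx.1.trans_le hz.1)).ne'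
      · exact (hz.2.trans_lt hj).ne).continuousWithinAt
  obtain ⟨r, hr, hrt⟩ := intermediate_value_Icc' hkx.2.le hcont ⟨hy.le, hx.le⟩
  exact ⟨r, hkx.1.trans_le hr.1, hrt, fun j => (hsep j).imp_right hr.2.trans_lt⟩

open Polynomial in
/-- Vieta's formula for the solutions of `∑ₖ aₖ/(x - cₖ) = t`. -/
lemma sum_roots_sub_poles {ι : Type*} [Fintype ι] {a c r : ι → ℝ} {t : ℝ} (ht : t ≠ 0)
    (hr : Function.Injective r) (hrc : ∀ k j, r k ≠ c j)
    (hroot : ∀ k, ∑ j, a j / (r k - c j) = t) :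
    ∑ k, (r k - c k) = (∑ k, a k) / t := by
  classical
  rcases isEmpty_or_nonempty ι with hι | hι
  · simp
  have hcard : 0 < (Finset.univ : Finset ι).card := Finset.card_pos.2 Finset.univ_nonempty
  let R : ℝ[X] := ∏ k, (X - C (r k))
  let Q : ℝ[X] := ∏ k, (X - C (c k))
  let S : ℝ[X] := ∑ k, C (a k) * ∏ j ∈ Finset.univ.erase k, (X - C (c j))
  have hdeg (k : ι) : (∏ j ∈ Finset.univ.erase k, (X - C (c j))).natDegree =
      (Finset.univ : Finset ι).card - 1 := by
    rw [natDegree_finsetProd_X_sub_C_eq_card, Finset.card_erase_of_mem (Finset.mem_univ k)]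
  have hS : S.degree < (Finset.univ : Finset ι).card := by
    refine (degree_sum_le _ _).trans_lt ((Finset.sup_lt_iff (WithBot.bot_lt_coe _)).2 ?_)
    intro k _
    rw [← smul_eq_C_mul]
    refine ((degree_smul_le _ _).trans degree_le_natDegree).trans_lt ?_
    rw [hdeg]
    exact_mod_cast Nat.sub_lt hcard one_pos
  have hdegQ : Q.degree = (Finset.univ : Finset ι).card := by simp [Q, degree_prod]
  have hdegR : R.degree = (Finset.univ : Finset ι).card := by simp [R, degree_prod]
  have hQR : (Q - R).degree < (Finset.univ : Finset ι).card := by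
    rw [← hdegQ]
    exact degree_sub_lt_left (hdegQ.trans hdegR.symm) (monic_prod_X_sub_C _ _).ne_zero
      ((monic_prod_X_sub_C _ _).leadingCoeff.trans (monic_prod_X_sub_C _ _).leadingCoeff.symm)
  have hlt : (C t * (Q - R) - S).degree < (Finset.univ : Finset ι).card := by
    rw [← smul_eq_C_mul]
    exact (degree_sub_le _ _).trans_lt (max_lt ((degree_smul_le _ _).trans_lt hQR) hS)
  have hzero : C t * (Q - R) - S = 0 := by
    refine eq_zero_of_degree_lt_of_eval_index_eq_zero _ hr.injOn hlt fun k _ => ?_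
    have hR : R.eval (r k) = 0 := by
      simp only [R, eval_prod]
      exact Finset.prod_eq_zero (Finset.mem_univ k) (by simp)
    have hSQ : S.eval (r k) = t * Q.eval (r k) := by
      rw [← hroot k, Finset.sum_mul]
      simp only [S, Q, eval_finsetSum, eval_prod, eval_mul, eval_C, eval_sub, eval_X]
      refine Finset.sum_congr rfl fun j _ => ?_
      rw [← Finset.mul_prod_erase _ _ (Finset.mem_univ j)]
      have := sub_ne_zero.2 (hrc k j)
      field_simp
    simp [hR, hSQ]
  have hcoeff := congrArg (coeff · ((Finset.univ : Finset ι).card - 1)) hzero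
  have hScoeff : S.coeff ((Finset.univ : Finset ι).card - 1) = ∑ k, a k := by
    simp only [S, finsetSum_coeff, coeff_C_mul]
    refine Finset.sum_congr rfl fun k _ => ?_
    have hmonic := monic_prod_X_sub_C c (Finset.univ.erase k)
    rw [Monic, leadingCoeff, hdeg] at hmonic
    rw [hmonic, mul_one]
  simp only [coeff_sub, coeff_C_mul, coeff_zero, hScoeff, Q, R,
    prod_X_sub_C_coeff_card_pred _ _ hcard] at hcoeff
  rw [eq_div_iff ht, Finset.sum_sub_distrib]
  linarith

/-- The superlevel sets of `∑ₖ aₖ/(x - cₖ)` have measure `(∑ₖ aₖ) / t`. -/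
lemma volume_lt_sum_div_sub {ι : Type*} [Fintype ι] {a c : ι → ℝ} (ha : ∀ k, 0 < a k)
    (hc : Function.Injective c) {t : ℝ} (ht : 0 < t) :
    volume {x : ℝ | t < ∑ k, a k / (x - c k)} = ENNReal.ofReal ((∑ k, a k) / t) := by
  choose r hcr hrt hsep using exists_sum_div_sub_eq ha hc ht
  have hlt {j k : ι} (h : c j < c k) : r j < c k := (hsep j k).resolve_left h.not_ge
  have hrc (k j : ι) : r k ≠ c j := by
    rcases hsep k j with h | h
    · exact (h.trans_lt (hcr k)).ne'
    · exact h.ne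
  have hr : Function.Injective r := fun j k h => by
    by_contra hjk
    rcases (hc.ne hjk).lt_or_gt with hl | hl
    · exact ((hlt hl).trans (hcr k)).ne h
    · exact ((hlt hl).trans (hcr j)).ne' h
  have hset : {x : ℝ | t < ∑ k, a k / (x - c k)} =ᵐ[volume] ⋃ k, Ioo (c k) (r k) := by
    filter_upwards [(finite_range c).measure_zero volume |> measure_eq_zero_iff_ae_notMem.1]
      with x hx
    have hxc (j : ι) : c j ≠ x := fun h => hx ⟨j, h⟩
    refine propext (show t < _ ↔ x ∈ ⋃ k, Ioo (c k) (r k) from ?_)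
    rw [mem_iUnion]
    constructor
    · intro h
      have hne : (Finset.univ.filter fun j => c j < x).Nonempty := by
        by_contra hempty
        rw [Finset.not_nonempty_iff_eq_empty, Finset.filter_eq_empty_iff] at hempty
        refine (ht.trans h).not_ge (Finset.sum_nonpos fun j hj => ?_)
        exact div_nonpos_of_nonneg_of_nonpos (ha j).le (sub_nonpos.2 (not_lt.1 (hempty hj)))
      obtain ⟨m, hm, hmax⟩ := Finset.exists_max_image _ c hne
      refine ⟨m, (Finset.mem_filter.1 hm).2, not_le.1 fun hmx => h.not_ge ?_⟩
      rw [← hrt m]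
      refine sum_div_sub_le_of_no_pole ha hmx fun j => ?_
      rcases (hxc j).lt_or_gt with hj | hj
      · exact Or.inl ((hmax j (Finset.mem_filter.2 ⟨Finset.mem_univ j, hj⟩)).trans_lt (hcr m))
      · exact Or.inr hj
    · rintro ⟨k, hkx, hxr⟩
      have : Nonempty ι := ⟨k⟩
      rw [← hrt k]
      exact sum_div_sub_lt_of_no_pole ha hxr fun j =>
        (hsep k j).imp_left fun hj => hj.trans_lt hkx
  have hdisj : Pairwise (Function.onFun Disjoint fun k => Ioo (c k) (r k)) := fun j k hjk => by
    refine Set.disjoint_left.2 fun x hj hk => ?_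
    rcases (hc.ne hjk).lt_or_gt with hl | hl
    · exact ((hk.1.trans hj.2).trans (hlt hl)).false
    · exact ((hj.1.trans hk.2).trans (hlt hl)).false
  rw [measure_congr hset, measure_iUnion hdisj fun _ => measurableSet_Ioo, tsum_fintype,
    ← sum_roots_sub_poles ht.ne' hr hrc hrt,
    ENNReal.ofReal_sum_of_nonneg fun k _ => (sub_pos.2 (hcr k)).le]
  simp only [Real.volume_Ioo]

/-- The sublevel sets of `∑ₖ aₖ/(x - cₖ)` have measure `(∑ₖ aₖ) / t`. -/
lemma volume_sum_div_sub_lt_neg {ι : Type*} [Fintype ι] {a c : ι → ℝ} (ha : ∀ k, 0 < a k)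
    (hc : Function.Injective c) {t : ℝ} (ht : 0 < t) :
    volume {x : ℝ | ∑ k, a k / (x - c k) < -t} = ENNReal.ofReal ((∑ k, a k) / t) := by
  rw [← volume_lt_sum_div_sub (c := fun k => -c k) ha (neg_injective.comp hc) ht,
    ← Measure.measure_neg]
  congr 1
  ext x
  have h : ∑ k, a k / (x - -c k) = -∑ k, a k / (-x - c k) := by
    rw [← Finset.sum_neg_distrib]
    refine Finset.sum_congr rfl fun j _ => ?_
    rw [← div_neg]
    ring_nf
  simp only [Set.mem_neg, mem_ofPred_eq, h]
  exact lt_neg.symm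

/-- Loomis' identity: for `ν = ∑ₖ aₖ δ_{cₖ}` with distinct `cₖ ∈ ℝ` and `aₖ > 0`,
the Hilbert transform `Hν(x) = (1/π) ∑ₖ aₖ/(x - cₖ)` satisfies
`|{|Hν| > λ}| = (2/(πλ)) ∑ₖ aₖ` for every `λ > 0`. -/
theorem loomis_identity_hilbert_transform_diracs
    (N : ℕ) (c : Fin N → ℝ) (hc : Function.Injective c)
    (a : Fin N → ℝ) (ha : ∀ k, 0 < a k) (lam : ℝ) (hlam : 0 < lam) :
    volume {x : ℝ | lam < |(1 / Real.pi) * ∑ k, a k / (x - c k)|} =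
      ENNReal.ofReal ((2 / (Real.pi * lam)) * ∑ k, a k) := by
  have ht : 0 < Real.pi * lam := mul_pos Real.pi_pos hlam
  have hset : {x : ℝ | lam < |(1 / Real.pi) * ∑ k, a k / (x - c k)|} =
      {x : ℝ | Real.pi * lam < ∑ k, a k / (x - c k)} ∪
        {x : ℝ | ∑ k, a k / (x - c k) < -(Real.pi * lam)} := by
    ext x
    simp only [mem_ofPred_eq, mem_union]
    rw [abs_mul, abs_of_pos (one_div_pos.2 Real.pi_pos), one_div_mul_eq_div,
      lt_div_iff₀' Real.pi_pos, lt_abs, lt_neg]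
  have hdisj : Disjoint {x : ℝ | Real.pi * lam < ∑ k, a k / (x - c k)}
      {x : ℝ | ∑ k, a k / (x - c k) < -(Real.pi * lam)} :=
    Set.disjoint_left.2 fun x h₁ h₂ => by
      rw [mem_ofPred_eq] at h₁ h₂
      linarith
  have hA : 0 ≤ (∑ k, a k) / (Real.pi * lam) :=
    div_nonneg (Finset.sum_nonneg fun k _ => (ha k).le) ht.le
  rw [hset, measure_union hdisj (measurableSet_lt (by fun_prop) measurable_const),
    volume_lt_sum_div_sub ha hc ht, volume_sum_div_sub_lt_neg ha hc ht,
    ← ENNReal.ofReal_add hA hA]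
  congr 1
  ring
end

section
/- Let n ≥ 1 and let U ⊆ ℝⁿ be a nonempty open proper subset of ℝⁿ. Then U can be written as a countable union U = ⋃_{k=1}^∞ Q_k of pairwise disjoint dyadic cubes Q_k such that (2n − 1)·diam(Q_k) ≤ dist(Q_k, ℝⁿ∖U) for every k. -/
open Set Metric

/-- A dyadic cube in `ℝⁿ`: a product of half-open intervals
`[ℓᵢ 2^{-m}, (ℓᵢ+1) 2^{-m})` with `m ∈ ℤ` and `ℓᵢ ∈ ℤ`. -/
def IsDyadicCube {n : ℕ} (Q : Set (EuclideanSpace ℝ (Fin n))) : Prop :=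
  ∃ (m : ℤ) (l : Fin n → ℤ),
    Q = {x : EuclideanSpace ℝ (Fin n) |
      ∀ i, (l i : ℝ) * (2 : ℝ) ^ (-m) ≤ x i ∧ x i < ((l i : ℝ) + 1) * (2 : ℝ) ^ (-m)}

/-- The dyadic cube of generation `m` containing the point `x`. -/
def dyadicCubeAt {n : ℕ} (m : ℤ) (x : EuclideanSpace ℝ (Fin n)) :
    Set (EuclideanSpace ℝ (Fin n)) :=
  {y | ∀ i, ⌊y i * (2 : ℝ) ^ m⌋ = ⌊x i * (2 : ℝ) ^ m⌋}

section DyadicCubeAt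

variable {n : ℕ} {m k : ℤ} {x y z : EuclideanSpace ℝ (Fin n)}

theorem self_mem_dyadicCubeAt : x ∈ dyadicCubeAt m x := fun _ => rfl

theorem dyadicCubeAt_eq_of_mem (h : y ∈ dyadicCubeAt m x) :
    dyadicCubeAt m y = dyadicCubeAt m x := by
  ext z
  simp only [dyadicCubeAt, mem_ofPred_eq] at h ⊢
  simp only [h]

theorem dyadicCubeAt_eq_setOf :
    dyadicCubeAt m x = {y : EuclideanSpace ℝ (Fin n) |
      ∀ i, (⌊x i * (2 : ℝ) ^ m⌋ : ℝ) * (2 : ℝ) ^ (-m) ≤ y i ∧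
        y i < ((⌊x i * (2 : ℝ) ^ m⌋ : ℝ) + 1) * (2 : ℝ) ^ (-m)} := by
  ext y
  have hp : (0 : ℝ) < 2 ^ m := by positivity
  simp only [dyadicCubeAt, mem_ofPred_eq, Int.floor_eq_iff, zpow_neg, ← div_eq_mul_inv,
    div_le_iff₀ hp, lt_div_iff₀ hp]

theorem isDyadicCube_dyadicCubeAt : IsDyadicCube (dyadicCubeAt m x) :=
  ⟨m, fun i => ⌊x i * (2 : ℝ) ^ m⌋, dyadicCubeAt_eq_setOf⟩

theorem dyadicCubeAt_anti (hkm : k ≤ m) : dyadicCubeAt m x ⊆ dyadicCubeAt k x := by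
  intro y hy i
  obtain ⟨d, rfl⟩ := Int.le.dest hkm
  have key (t : ℝ) : ⌊t * (2 : ℝ) ^ k⌋ = ⌊t * (2 : ℝ) ^ (k + d : ℤ)⌋ / ((2 ^ d : ℕ) : ℤ) := by
    rw [← Int.floor_div_natCast, zpow_add₀ two_ne_zero, zpow_natCast]
    congr 1
    push_cast
    field_simp
  rw [key, key, hy i]

theorem dist_le_of_mem_dyadicCubeAt (hy : y ∈ dyadicCubeAt m x) (hz : z ∈ dyadicCubeAt m x) :
    dist y z ≤ √n * (2 : ℝ) ^ (-m) := by
  rw [dyadicCubeAt_eq_setOf] at hy hz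
  rw [EuclideanSpace.dist_eq]
  have hp : (0 : ℝ) < 2 ^ (-m) := by positivity
  have hcoord (i : Fin n) : dist (y i) (z i) ^ 2 ≤ ((2 : ℝ) ^ (-m)) ^ 2 := by
    refine pow_le_pow_left₀ dist_nonneg ?_ 2
    rw [Real.dist_eq, abs_le]
    have hyi := hy i
    have hzi := hz i
    constructor <;> linarith
  calc √(∑ i, dist (y i) (z i) ^ 2) ≤ √(∑ _i : Fin n, ((2 : ℝ) ^ (-m)) ^ 2) :=
        Real.sqrt_le_sqrt (Finset.sum_le_sum fun i _ => hcoord i)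
    _ = √n * (2 : ℝ) ^ (-m) := by
        rw [Finset.sum_const, Finset.card_univ, Fintype.card_fin, nsmul_eq_mul,
          Real.sqrt_mul (Nat.cast_nonneg n), Real.sqrt_sq hp.le]

theorem diam_dyadicCubeAt_le : diam (dyadicCubeAt m x) ≤ √n * (2 : ℝ) ^ (-m) :=
  diam_le_of_forall_dist_le (by positivity) fun _ hy _ hz => dist_le_of_mem_dyadicCubeAt hy hz

end DyadicCubeAt

theorem countable_setOf_isDyadicCube (n : ℕ) :
    {Q : Set (EuclideanSpace ℝ (Fin n)) | IsDyadicCube Q}.Countable := by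
  refine (countable_range fun p : ℤ × (Fin n → ℤ) => {x : EuclideanSpace ℝ (Fin n) |
    ∀ i, (p.2 i : ℝ) * (2 : ℝ) ^ (-p.1) ≤ x i ∧
      x i < ((p.2 i : ℝ) + 1) * (2 : ℝ) ^ (-p.1)}).mono ?_
  rintro Q ⟨m, l, rfl⟩
  exact ⟨(m, l), rfl⟩

/-- Whitney decomposition with an arbitrary separation constant `c > 0`, measured against
the side length of the cubes. -/
theorem exists_whitney_generation {n : ℕ} {c : ℝ} (hc : 0 < c)
    {U : Set (EuclideanSpace ℝ (Fin n))} (hUopen : IsOpen U) (hUproper : U ≠ univ) :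
    ∃ g : EuclideanSpace ℝ (Fin n) → ℤ, ∀ x ∈ U,
      (∀ z ∈ dyadicCubeAt (g x) x, ∀ y ∉ U, c * (2 : ℝ) ^ (-g x) ≤ dist z y) ∧
      ∀ m, (∀ z ∈ dyadicCubeAt m x, ∀ y ∉ U, c * (2 : ℝ) ^ (-m) ≤ dist z y) → g x ≤ m := by
  have small (ε : ℝ) (hε : 0 < ε) : ∃ N : ℕ, (2 : ℝ) ^ (-(N : ℤ)) < ε := by
    obtain ⟨N, hN⟩ := exists_pow_lt_of_lt_one hε (by norm_num : (1 / 2 : ℝ) < 1)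
    exact ⟨N, by simpa using hN⟩
  have hex (x : EuclideanSpace ℝ (Fin n)) : ∃ k : ℤ, x ∈ U →
      (∀ z ∈ dyadicCubeAt k x, ∀ y ∉ U, c * (2 : ℝ) ^ (-k) ≤ dist z y) ∧
      ∀ m, (∀ z ∈ dyadicCubeAt m x, ∀ y ∉ U, c * (2 : ℝ) ^ (-m) ≤ dist z y) → k ≤ m := by
    by_cases hx : x ∈ U
    swap
    · exact ⟨0, fun h => absurd h hx⟩
    obtain ⟨y₀, hy₀⟩ := (ne_univ_iff_exists_notMem U).mp hUproper
    obtain ⟨ε, hε, hball⟩ := Metric.isOpen_iff.mp hUopen x hx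
    have hd : 0 < dist x y₀ := dist_pos.mpr fun h => hy₀ (h ▸ hx)
    suffices h : ∃ k : ℤ,
        (∀ z ∈ dyadicCubeAt k x, ∀ y ∉ U, c * (2 : ℝ) ^ (-k) ≤ dist z y) ∧
        ∀ m, (∀ z ∈ dyadicCubeAt m x, ∀ y ∉ U, c * (2 : ℝ) ^ (-m) ≤ dist z y) → k ≤ m from
      h.imp fun _ hk _ => hk
    apply Int.exists_least_of_bdd
    · obtain ⟨N, hN⟩ := small (c / dist x y₀) (by positivity)
      refine ⟨-N, fun m hm => ?_⟩
      by_contra! hlt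
      have h1 := hm x self_mem_dyadicCubeAt y₀ hy₀
      have h2 : (2 : ℝ) ^ (N : ℤ) ≤ 2 ^ (-m) :=
        zpow_le_zpow_right₀ one_le_two (by omega)
      rw [lt_div_iff₀ hd, zpow_neg, inv_mul_lt_iff₀ (by positivity)] at hN
      nlinarith [mul_le_mul_of_nonneg_left h2 hc.le]
    · have hs : 0 < c + √n := by positivity
      obtain ⟨N, hN⟩ := small (ε / (c + √n)) (by positivity)
      refine ⟨N, fun z hz y hy => ?_⟩
      rw [lt_div_iff₀ hs] at hN
      have h1 : ε ≤ dist y x := by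
        by_contra! h
        exact hy (hball h)
      have h2 := dist_le_of_mem_dyadicCubeAt hz self_mem_dyadicCubeAt
      have h3 := dist_triangle_left y x z
      linarith
  choose g hg using hex
  exact ⟨g, hg⟩

/-- Dimensional Whitney decomposition: every nonempty open proper subset `U` of
`ℝⁿ` is a countable disjoint union of dyadic cubes `Q` with
`(2n - 1) diam(Q) ≤ dist(Q, ℝⁿ∖U)`. -/
theorem whitney_decomposition_dimensional (n : ℕ) (hn : 1 ≤ n)
    (U : Set (EuclideanSpace ℝ (Fin n))) (hUopen : IsOpen U)
    (hUne : U.Nonempty) (hUproper : U ≠ univ) :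
    ∃ 𝒬 : Set (Set (EuclideanSpace ℝ (Fin n))),
      𝒬.Countable ∧
      (∀ Q ∈ 𝒬, IsDyadicCube Q) ∧
      (∀ Q ∈ 𝒬, ∀ Q' ∈ 𝒬, Q ≠ Q' → Disjoint Q Q') ∧
      U = ⋃₀ 𝒬 ∧
      ∀ Q ∈ 𝒬, ∀ x ∈ Q, ∀ y ∉ U,
        (2 * (n : ℝ) - 1) * diam Q ≤ dist x y := by
  have hn' : (1 : ℝ) ≤ n := by exact_mod_cast hn
  have hfac : 0 < 2 * (n : ℝ) - 1 := by linarith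
  have hc : 0 < (2 * (n : ℝ) - 1) * √n := mul_pos hfac (Real.sqrt_pos.mpr (by linarith))
  obtain ⟨g, hg⟩ := exists_whitney_generation hc hUopen hUproper
  have hsub : ∀ x ∈ U, dyadicCubeAt (g x) x ⊆ U := by
    intro x hx z hz
    by_contra hzU
    have h := (hg x hx).1 z hz z hzU
    rw [dist_self] at h
    exact h.not_gt (by positivity)
  have heq : ∀ x ∈ U, ∀ y ∈ dyadicCubeAt (g x) x,
      dyadicCubeAt (g y) y = dyadicCubeAt (g x) x := by
    intro x hx y hy
    have hyU := hsub x hx hy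
    have hcube := dyadicCubeAt_eq_of_mem hy
    have hyx : g y ≤ g x := (hg y hyU).2 _ (hcube ▸ (hg x hx).1)
    have hcube' := dyadicCubeAt_eq_of_mem (dyadicCubeAt_anti hyx hy)
    have hxy : g x ≤ g y := (hg x hx).2 _ (hcube' ▸ (hg y hyU).1)
    rw [le_antisymm hyx hxy, hcube]
  have hdyadic : ∀ Q ∈ (fun x => dyadicCubeAt (g x) x) '' U, IsDyadicCube Q := by
    rintro _ ⟨x, -, rfl⟩
    exact isDyadicCube_dyadicCubeAt
  refine ⟨(fun x => dyadicCubeAt (g x) x) '' U, (countable_setOf_isDyadicCube n).mono hdyadic,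
    hdyadic, ?_, ?_, ?_⟩
  · rintro _ ⟨x, hx, rfl⟩ _ ⟨x', hx', rfl⟩ hne
    refine Set.disjoint_left.mpr fun z hz hz' => hne ?_
    exact (heq x hx z hz).symm.trans (heq x' hx' z hz')
  · refine Subset.antisymm (fun x hx => ⟨_, ⟨x, hx, rfl⟩, self_mem_dyadicCubeAt⟩) ?_
    rintro z ⟨_, ⟨x, hx, rfl⟩, hz⟩
    exact hsub x hx hz
  · rintro _ ⟨x, hx, rfl⟩ z hz y hy
    calc (2 * (n : ℝ) - 1) * diam (dyadicCubeAt (g x) x)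
        ≤ (2 * (n : ℝ) - 1) * (√n * (2 : ℝ) ^ (-g x)) :=
          mul_le_mul_of_nonneg_left diam_dyadicCubeAt_le hfac.le
      _ = (2 * (n : ℝ) - 1) * √n * (2 : ℝ) ^ (-g x) := (mul_assoc _ _ _).symm
      _ ≤ dist z y := (hg x hx).1 z hz y hy
end

section
/- There exists an absolute constant C > 0 such that for every n ≥ 2, every j ∈ {1,…,n}, and every y ∈ ℝⁿ with y ≠ 0, one has ∫_{{x ∈ ℝⁿ : |x| > n|y|}} |K_j(x − y) − K_j(x)| dx ≤ C, where K_j(x) := c_n x_j/|x|^{n+1} is the kernel of the j-th Riesz transform. -/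
open MeasureTheory Set

/-- The normalizing constant of the Riesz transform kernel. -/
noncomputable def rieszConst (n : ℕ) : ℝ :=
  Real.Gamma (((n : ℝ) + 1) / 2) / Real.pi ^ (((n : ℝ) + 1) / 2)

/-- The kernel of the `j`-th Riesz transform: `K_j(x) = c_n x_j/|x|^{n+1}`. -/
noncomputable def rieszKernel (n : ℕ) (j : Fin n) (x : EuclideanSpace ℝ (Fin n)) : ℝ :=
  rieszConst n * x j / ‖x‖ ^ (n + 1)

/-- A form of Gautschi's inequality: `Γ(s + 1/2) ≤ √s Γ(s)`. -/
lemma Real.Gamma_add_half_le {s : ℝ} (hs : 0 < s) :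
    Real.Gamma (s + 1 / 2) ≤ √s * Real.Gamma s := by
  have h := Real.Gamma_mul_add_mul_le_rpow_Gamma_mul_rpow_Gamma hs (by linarith : 0 < s + 1)
    (by norm_num : (0 : ℝ) < 1 / 2) (by norm_num : (0 : ℝ) < 1 / 2) (by norm_num)
  have hG := (Real.Gamma_pos_of_pos hs).le
  calc Real.Gamma (s + 1 / 2) = Real.Gamma (1 / 2 * s + 1 / 2 * (s + 1)) := by ring_nf
    _ ≤ _ := h
    _ = √(Real.Gamma s) * (√s * √(Real.Gamma s)) := by
      rw [Real.Gamma_add_one hs.ne', ← Real.sqrt_eq_rpow, ← Real.sqrt_eq_rpow,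
        Real.sqrt_mul hs.le]
    _ = √s * Real.Gamma s := by
      rw [mul_left_comm, Real.mul_self_sqrt hG]

lemma rieszConst_nonneg (n : ℕ) : 0 ≤ rieszConst n :=
  div_nonneg (Real.Gamma_nonneg_of_nonneg (by positivity)) (by positivity)

/-- The normalizing constant times the surface area of the unit sphere is at most `√n`. -/
lemma rieszConst_mul_sphere_area_le {n : ℕ} (hn : 1 ≤ n) :
    rieszConst n * (n * volume.real (Metric.ball (0 : EuclideanSpace ℝ (Fin n)) 1)) ≤ √n := by
  have : Nonempty (Fin n) := ⟨⟨0, hn⟩⟩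
  have hn0 : (0 : ℝ) < n := by exact_mod_cast hn
  have hG := Real.Gamma_pos_of_pos (half_pos hn0)
  have hpi := Real.sqrt_pos.2 Real.pi_pos
  have hvol : volume.real (Metric.ball (0 : EuclideanSpace ℝ (Fin n)) 1)
      = √Real.pi ^ n / ((n : ℝ) / 2 * Real.Gamma ((n : ℝ) / 2)) := by
    rw [measureReal_def, EuclideanSpace.volume_ball, Real.Gamma_add_one (by positivity)]
    simp only [ENNReal.ofReal_one, one_pow, one_mul, Fintype.card_fin]
    rw [ENNReal.toReal_ofReal (by positivity)]
  have hpow : Real.pi ^ (((n : ℝ) + 1) / 2) = √Real.pi ^ n * √Real.pi := by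
    rw [← pow_succ, Real.sqrt_eq_rpow, ← Real.rpow_natCast, ← Real.rpow_mul Real.pi_pos.le]
    congr 1
    push_cast
    ring
  have hgam := Real.Gamma_add_half_le (half_pos hn0)
  have hsplit : √(n : ℝ) = √((n : ℝ) / 2) * √2 := by
    rw [← Real.sqrt_mul (by positivity)]
    congr 1
    ring
  have h2 : (2 : ℝ) ≤ √2 * √Real.pi := by
    rw [← Real.sqrt_mul (by norm_num)]
    exact Real.le_sqrt_of_sq_le (by nlinarith [Real.pi_gt_three])
  calc rieszConst n * (n * volume.real (Metric.ball (0 : EuclideanSpace ℝ (Fin n)) 1))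
      = Real.Gamma ((n : ℝ) / 2 + 1 / 2) * 2 / (√Real.pi * Real.Gamma ((n : ℝ) / 2)) := by
        rw [hvol, rieszConst, hpow, ← add_div]
        field_simp
    _ ≤ √((n : ℝ) / 2) * Real.Gamma ((n : ℝ) / 2) * (√2 * √Real.pi)
          / (√Real.pi * Real.Gamma ((n : ℝ) / 2)) := by gcongr
    _ = √n := by
      rw [hsplit]
      field_simp

lemma lintegral_inv_norm_pow_compl_ball {n : ℕ} (hn : 1 ≤ n) {R : ℝ} (hR : 0 < R) :
    ∫⁻ x in {x : EuclideanSpace ℝ (Fin n) | R < ‖x‖}, ENNReal.ofReal (1 / ‖x‖ ^ (n + 1))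
      = ENNReal.ofReal
          (n * volume.real (Metric.ball (0 : EuclideanSpace ℝ (Fin n)) 1) / R) := by
  have : Nonempty (Fin n) := ⟨⟨0, hn⟩⟩
  have hS : MeasurableSet {x : EuclideanSpace ℝ (Fin n) | R < ‖x‖} :=
    (isOpen_lt continuous_const continuous_norm).measurableSet
  set f : ℝ → ℝ := (Ioi R).indicator fun r ↦ 1 / r ^ (n + 1) with hf
  have hfun : (fun y : ℝ ↦ y ^ (Module.finrank ℝ (EuclideanSpace ℝ (Fin n)) - 1) • f y)
      = (Ioi R).indicator fun r ↦ r ^ (-2 : ℝ) := by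
    ext r
    by_cases hr : r ∈ Ioi R
    · have hr0 : 0 < r := hR.trans hr
      obtain ⟨k, rfl⟩ := Nat.exists_eq_add_of_le' hn
      simp only [hf, indicator_of_mem hr, finrank_euclideanSpace, Fintype.card_fin, smul_eq_mul,
        Nat.add_sub_cancel, Real.rpow_neg hr0.le, Real.rpow_two]
      field_simp
      ring
    · simp [hf, indicator_of_notMem hr]
  have hsub : Ioi (0 : ℝ) ∩ Ioi R = Ioi R := inter_eq_right.2 (Ioi_subset_Ioi hR.le)
  have hint : Integrable (fun x : EuclideanSpace ℝ (Fin n) ↦ f ‖x‖) := by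
    rw [integrable_fun_norm_addHaar volume (f := f), hfun]
    exact ((integrableOn_Ioi_rpow_of_lt (by norm_num) hR).integrable_indicator
      measurableSet_Ioi).integrableOn
  have hval : ∫ x : EuclideanSpace ℝ (Fin n), f ‖x‖
      = n * volume.real (Metric.ball (0 : EuclideanSpace ℝ (Fin n)) 1) / R := by
    rw [integral_fun_norm_addHaar volume f, hfun, setIntegral_indicator measurableSet_Ioi, hsub,
      integral_Ioi_rpow_of_lt (by norm_num) hR]
    norm_num [Real.rpow_neg hR.le]
    ring
  rw [← hval, ofReal_integral_eq_lintegral_ofReal hint, ← lintegral_indicator hS]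
  · refine lintegral_congr fun x ↦ ?_
    by_cases hx : R < ‖x‖ <;> simp [hf, indicator, hx]
  · refine .of_forall fun x ↦ ?_
    simp only [hf, Pi.zero_apply]
    refine indicator_nonneg (fun r hr ↦ ?_) _
    have : 0 < r := hR.trans hr
    positivity

/-- Symmetry in the coordinates: `n x_j² / |x|²` averages to `1` against radial weights. -/
lemma lintegral_coord_sq_compl_ball {n : ℕ} {R : ℝ} (hR : 0 < R) (j : Fin n) :
    ∫⁻ x in {x : EuclideanSpace ℝ (Fin n) | R < ‖x‖},
        ENNReal.ofReal (n * (x j) ^ 2 / ‖x‖ ^ (n + 3))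
      = ∫⁻ x in {x : EuclideanSpace ℝ (Fin n) | R < ‖x‖},
        ENNReal.ofReal (1 / ‖x‖ ^ (n + 1)) := by
  set S := {x : EuclideanSpace ℝ (Fin n) | R < ‖x‖} with hSdef
  have hS : MeasurableSet S := (isOpen_lt continuous_const continuous_norm).measurableSet
  let g (i : Fin n) (x : EuclideanSpace ℝ (Fin n)) : ENNReal :=
    ENNReal.ofReal ((x i) ^ 2 / ‖x‖ ^ (n + 3))
  have hg (i : Fin n) : Measurable (g i) := by fun_prop
  have hsymm (i : Fin n) : ∫⁻ x in S, g i x = ∫⁻ x in S, g j x := by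
    let e : EuclideanSpace ℝ (Fin n) ≃ₗᵢ[ℝ] EuclideanSpace ℝ (Fin n) :=
      LinearIsometryEquiv.piLpCongrLeft 2 ℝ ℝ (Equiv.swap i j)
    have hpre : e ⁻¹' S = S := by
      ext x
      simp [hSdef, e.norm_map]
    have h := e.measurePreserving.setLIntegral_comp_preimage hS (hg i)
    rw [hpre] at h
    rw [← h]
    refine lintegral_congr fun x ↦ ?_
    simp only [g, e.norm_map]
    simp [e, LinearIsometryEquiv.piLpCongrLeft_apply]
  calc ∫⁻ x in S, ENNReal.ofReal (n * (x j) ^ 2 / ‖x‖ ^ (n + 3))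
      = ∫⁻ x in S, (n : ENNReal) * g j x := by
        refine lintegral_congr fun x ↦ ?_
        rw [mul_div_assoc, ENNReal.ofReal_mul (by positivity), ENNReal.ofReal_natCast]
    _ = ∑ i, ∫⁻ x in S, g i x := by
      rw [lintegral_const_mul _ (hg j)]
      simp [hsymm]
    _ = ∫⁻ x in S, ∑ i, g i x := (lintegral_finsetSum _ fun i _ ↦ hg i).symm
    _ = ∫⁻ x in S, ENNReal.ofReal (1 / ‖x‖ ^ (n + 1)) := by
      refine setLIntegral_congr_fun hS fun x hx ↦ ?_
      have hx0 : 0 < ‖x‖ := hR.trans hx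
      simp only [g]
      rw [← ENNReal.ofReal_sum_of_nonneg fun i _ ↦ by positivity, ← Finset.sum_div]
      have hnorm : ∑ i, (x i) ^ 2 = ‖x‖ ^ 2 := by
        simp [EuclideanSpace.norm_sq_eq]
      rw [hnorm]
      congr 1
      field_simp
      ring

lemma one_add_inv_pow_le_three (n : ℕ) : (1 + (n : ℝ)⁻¹) ^ n ≤ 3 :=
  Real.one_add_inv_pow_le_exp.trans (by linarith [Real.exp_one_lt_d9])

lemma inv_pow_le_of_abs_sub_le {n : ℕ} (hn : 2 ≤ n) {a b t : ℝ} (ht : 0 ≤ t)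
    (hta : n * t < a) (hab : |b - a| ≤ t) : 0 < b ∧ 1 / b ^ (n + 1) ≤ 12 / a ^ (n + 1) := by
  obtain ⟨k, rfl⟩ := Nat.exists_eq_add_of_le' (by omega : 1 ≤ n)
  have hk : (1 : ℝ) ≤ k := by exact_mod_cast (by omega : 1 ≤ k)
  have hb1 : a - t ≤ b := by linarith [(abs_le.1 hab).1]
  push_cast at hta
  have hkb : k * t < b := by linarith
  have hb : 0 < b := lt_of_le_of_lt (by positivity) hkb
  have ha : 0 < a := lt_of_le_of_lt (by positivity) hta
  refine ⟨hb, ?_⟩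
  have hle : a ≤ (1 + (k : ℝ)⁻¹) * b := by
    have : t ≤ (k : ℝ)⁻¹ * b := by
      rw [inv_mul_eq_div, le_div_iff₀ (by positivity)]
      linarith
    linarith
  have hc : (1 + (k : ℝ)⁻¹) ^ (k + 1 + 1) ≤ 12 := by
    have h1 : (k : ℝ)⁻¹ ≤ 1 := inv_le_one_of_one_le₀ hk
    have h0 : 0 ≤ (k : ℝ)⁻¹ := by positivity
    calc (1 + (k : ℝ)⁻¹) ^ (k + 1 + 1) = (1 + (k : ℝ)⁻¹) ^ k * (1 + (k : ℝ)⁻¹) ^ 2 := by ring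
      _ ≤ 3 * (1 + 1) ^ 2 := by
        gcongr
        exact one_add_inv_pow_le_three k
      _ = 12 := by norm_num
  rw [div_le_div_iff₀ (by positivity) (by positivity), one_mul]
  calc a ^ (k + 1 + 1) ≤ ((1 + (k : ℝ)⁻¹) * b) ^ (k + 1 + 1) := by gcongr
    _ = (1 + (k : ℝ)⁻¹) ^ (k + 1 + 1) * b ^ (k + 1 + 1) := mul_pow _ _ _
    _ ≤ 12 * b ^ (k + 1 + 1) := by gcongr

lemma abs_inv_pow_sub_inv_pow_le {n : ℕ} (hn : 2 ≤ n) {a b t : ℝ} (ht : 0 ≤ t)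
    (hta : n * t < a) (hab : |b - a| ≤ t) :
    |1 / b ^ (n + 1) - 1 / a ^ (n + 1)| ≤ 72 * n * t / a ^ (n + 2) := by
  obtain ⟨hb, hbi⟩ := inv_pow_le_of_abs_sub_le hn ht hta hab
  have ha : 0 < a := lt_of_le_of_lt (by positivity) hta
  have hn2 : (2 : ℝ) ≤ n := by exact_mod_cast hn
  have hmax : max |a| |b| ≤ (1 + (n : ℝ)⁻¹) * a := by
    have h0 : 0 ≤ (n : ℝ)⁻¹ := by positivity
    have : t ≤ (n : ℝ)⁻¹ * a := by
      rw [inv_mul_eq_div, le_div_iff₀ (by positivity)]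
      linarith
    rw [abs_of_pos ha, abs_of_pos hb]
    refine max_le ?_ ?_
    · nlinarith
    · linarith [(abs_le.1 hab).2]
  have hpow : |a ^ (n + 1) - b ^ (n + 1)| ≤ t * (2 * n) * (3 * a ^ n) := by
    calc |a ^ (n + 1) - b ^ (n + 1)|
        ≤ |a - b| * (n + 1 : ℕ) * max |a| |b| ^ n := abs_pow_sub_pow_le ..
      _ ≤ t * (2 * n) * (((1 + (n : ℝ)⁻¹) * a) ^ n) := by
        rw [abs_sub_comm]
        gcongr
        push_cast
        linarith
      _ ≤ t * (2 * n) * (3 * a ^ n) := by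
        rw [mul_pow]
        gcongr
        exact one_add_inv_pow_le_three n
  calc |1 / b ^ (n + 1) - 1 / a ^ (n + 1)|
      = |a ^ (n + 1) - b ^ (n + 1)| * (1 / b ^ (n + 1)) * (1 / a ^ (n + 1)) := by
        rw [← abs_of_pos (show 0 < 1 / b ^ (n + 1) by positivity),
          ← abs_of_pos (show 0 < 1 / a ^ (n + 1) by positivity), ← abs_mul, ← abs_mul,
          abs_of_pos (show 0 < 1 / b ^ (n + 1) by positivity),
          abs_of_pos (show 0 < 1 / a ^ (n + 1) by positivity)]
        congr 1
        field_simp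
    _ ≤ t * (2 * n) * (3 * a ^ n) * (12 / a ^ (n + 1)) * (1 / a ^ (n + 1)) := by gcongr
    _ = 72 * n * t / a ^ (n + 2) := by
      field_simp
      ring

lemma abs_rieszKernel_sub_le {n : ℕ} (hn : 2 ≤ n) (j : Fin n) {x y : EuclideanSpace ℝ (Fin n)}
    (hxy : n * ‖y‖ < ‖x‖) :
    |rieszKernel n j (x - y) - rieszKernel n j x| ≤
      12 * rieszConst n * ‖y‖ * ((1 + 3 * √n) * (1 / ‖x‖ ^ (n + 1))
        + 3 * √n * (n * (x j) ^ 2 / ‖x‖ ^ (n + 3))) := by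
  have hab : |‖x - y‖ - ‖x‖| ≤ ‖y‖ := by
    simpa using abs_norm_sub_norm_le (x - y) x
  have hc := rieszConst_nonneg n
  obtain ⟨hb, hbi⟩ := inv_pow_le_of_abs_sub_le hn (norm_nonneg y) hxy hab
  have hdiff := abs_inv_pow_sub_inv_pow_le hn (norm_nonneg y) hxy hab
  have hyj : |y j| ≤ ‖y‖ := by simpa using PiLp.norm_apply_le y j
  have ha : 0 < ‖x‖ := lt_of_le_of_lt (by positivity) hxy
  have hn0 : (0 : ℝ) < n := by exact_mod_cast (by omega : 0 < n)
  have hamgm : 2 * (√n * (|x j| * ‖x‖)) ≤ n * (x j) ^ 2 + ‖x‖ ^ 2 := by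
    have := two_mul_le_add_sq (√n * |x j|) ‖x‖
    rw [mul_pow, Real.sq_sqrt hn0.le, sq_abs] at this
    linarith
  have hcross : n * |x j| / ‖x‖ ^ (n + 2) ≤
      √n / 2 * (1 / ‖x‖ ^ (n + 1) + n * (x j) ^ 2 / ‖x‖ ^ (n + 3)) := by
    calc n * |x j| / ‖x‖ ^ (n + 2)
        = √n / 2 * (2 * (√n * (|x j| * ‖x‖)) / ‖x‖ ^ (n + 3)) := by
          field_simp
          rw [Real.sq_sqrt hn0.le]
          ring
      _ ≤ √n / 2 * ((n * (x j) ^ 2 + ‖x‖ ^ 2) / ‖x‖ ^ (n + 3)) := by gcongr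
      _ = _ := by
          field_simp
          ring
  have hsplit : rieszKernel n j (x - y) - rieszKernel n j x
      = rieszConst n * (x j * (1 / ‖x - y‖ ^ (n + 1) - 1 / ‖x‖ ^ (n + 1))
          - y j * (1 / ‖x - y‖ ^ (n + 1))) := by
    simp only [rieszKernel, PiLp.sub_apply]
    ring
  calc |rieszKernel n j (x - y) - rieszKernel n j x|
      ≤ rieszConst n * (|x j| * |1 / ‖x - y‖ ^ (n + 1) - 1 / ‖x‖ ^ (n + 1)|
          + |y j| * (1 / ‖x - y‖ ^ (n + 1))) := by
        rw [hsplit, abs_mul, abs_of_nonneg hc]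
        gcongr
        refine (abs_sub _ _).trans_eq ?_
        rw [abs_mul, abs_mul, abs_of_pos (show 0 < 1 / ‖x - y‖ ^ (n + 1) by positivity)]
    _ ≤ rieszConst n * (|x j| * (72 * n * ‖y‖ / ‖x‖ ^ (n + 2))
          + ‖y‖ * (12 / ‖x‖ ^ (n + 1))) := by gcongr
    _ = 12 * rieszConst n * ‖y‖ * (1 / ‖x‖ ^ (n + 1) + 6 * (n * |x j| / ‖x‖ ^ (n + 2))) := by
        ring
    _ ≤ 12 * rieszConst n * ‖y‖ * (1 / ‖x‖ ^ (n + 1)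
          + 6 * (√n / 2 * (1 / ‖x‖ ^ (n + 1) + n * (x j) ^ 2 / ‖x‖ ^ (n + 3)))) := by gcongr
    _ = _ := by ring

/-- Dimension-free Hörmander condition for the Riesz kernels with the enlarged
exclusion region `{|x| > n|y|}`:
`∫_{|x| > n|y|} |K_j(x-y) - K_j(x)| dx ≤ C` with `C` independent of `n`. -/
theorem riesz_kernel_hormander_dimension_free :
    ∃ C : ℝ, 0 < C ∧
      ∀ (n : ℕ), 2 ≤ n → ∀ (j : Fin n),
      ∀ y : EuclideanSpace ℝ (Fin n), y ≠ 0 →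
        (∫⁻ x in {x : EuclideanSpace ℝ (Fin n) | (n : ℝ) * ‖y‖ < ‖x‖},
            ENNReal.ofReal |rieszKernel n j (x - y) - rieszKernel n j x|) ≤
          ENNReal.ofReal C := by
  refine ⟨84, by norm_num, fun n hn j y hy ↦ ?_⟩
  have hy0 : 0 < ‖y‖ := norm_pos_iff.2 hy
  have hn1 : (1 : ℝ) ≤ n := by exact_mod_cast (by omega : 1 ≤ n)
  have hR : 0 < n * ‖y‖ := by positivity
  have hc := rieszConst_nonneg n
  have hsq : 1 ≤ √(n : ℝ) := Real.one_le_sqrt.2 hn1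
  have hS : MeasurableSet {x : EuclideanSpace ℝ (Fin n) | (n : ℝ) * ‖y‖ < ‖x‖} :=
    (isOpen_lt continuous_const continuous_norm).measurableSet
  set V := volume.real (Metric.ball (0 : EuclideanSpace ℝ (Fin n)) 1)
  have hcV : rieszConst n * (n * V) ≤ √n := rieszConst_mul_sphere_area_le (by omega)
  calc ∫⁻ x in {x : EuclideanSpace ℝ (Fin n) | (n : ℝ) * ‖y‖ < ‖x‖},
        ENNReal.ofReal |rieszKernel n j (x - y) - rieszKernel n j x|
      ≤ ∫⁻ x in {x : EuclideanSpace ℝ (Fin n) | (n : ℝ) * ‖y‖ < ‖x‖},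
          ENNReal.ofReal (12 * rieszConst n * ‖y‖) *
            (ENNReal.ofReal (1 + 3 * √n) * ENNReal.ofReal (1 / ‖x‖ ^ (n + 1))
              + ENNReal.ofReal (3 * √n) *
                ENNReal.ofReal (n * (x j) ^ 2 / ‖x‖ ^ (n + 3))) := by
        refine setLIntegral_mono' hS fun x hx ↦ ?_
        rw [← ENNReal.ofReal_mul (by positivity), ← ENNReal.ofReal_mul (by positivity),
          ← ENNReal.ofReal_add (by positivity) (by positivity),
          ← ENNReal.ofReal_mul (by positivity)]
        exact ENNReal.ofReal_le_ofReal (abs_rieszKernel_sub_le hn j hx)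
    _ = ENNReal.ofReal (12 * rieszConst n * ‖y‖) *
          (ENNReal.ofReal (1 + 3 * √n) * ENNReal.ofReal (n * V / (n * ‖y‖))
            + ENNReal.ofReal (3 * √n) * ENNReal.ofReal (n * V / (n * ‖y‖))) := by
        rw [lintegral_const_mul _ (by fun_prop), lintegral_add_left (by fun_prop),
          lintegral_const_mul _ (by fun_prop), lintegral_const_mul _ (by fun_prop),
          lintegral_coord_sq_compl_ball hR j,
          lintegral_inv_norm_pow_compl_ball (by omega) hR]
    _ = ENNReal.ofReal (12 * (1 + 6 * √n) * (rieszConst n * (n * V)) / n) := by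
        rw [← add_mul, ← ENNReal.ofReal_add (by positivity) (by positivity),
          ← ENNReal.ofReal_mul (by positivity), ← ENNReal.ofReal_mul (by positivity)]
        congr 1
        field_simp
        ring
    _ ≤ ENNReal.ofReal 84 := by
        refine ENNReal.ofReal_le_ofReal ?_
        rw [div_le_iff₀ (by positivity)]
        calc 12 * (1 + 6 * √n) * (rieszConst n * (n * V))
            ≤ 12 * (√n + 6 * √n) * √n := by gcongr
          _ = 84 * (√n * √n) := by ring
          _ = 84 * n := by rw [Real.mul_self_sqrt (by positivity)]
end

section
/- There exists an absolute constant C > 0 such that the following holds for every n ≥ 2 and j ∈ {1,…,n}. If μ is a finite signed Borel measure on ℝⁿ supported in the closed ball B(x₀, r) for some x₀ ∈ ℝⁿ and r > 0, and μ(B(x₀, r)) = 0, then ∫_{{y : |y − x₀| > nr}} |∫ K_j(y − z) dμ(z)| dy ≤ C ‖μ‖, where K_j(x) := c_n x_j/|x|^{n+1} and ‖μ‖ denotes the total variation of μ. -/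
open MeasureTheory Set Metric

open scoped ENNReal

/-- Second moments of a radial weight are the same in all directions of a given length. -/
lemma lintegral_radial_mul_inner_sq_congr {E : Type*} [NormedAddCommGroup E]
    [InnerProductSpace ℝ E] [FiniteDimensional ℝ E] [MeasurableSpace E] [BorelSpace E]
    (φ : ℝ → ℝ≥0∞) {u v : E} (h : ‖u‖ = ‖v‖) :
    ∫⁻ x : E, φ ‖x‖ * ENNReal.ofReal (inner ℝ x u ^ 2) =
      ∫⁻ x : E, φ ‖x‖ * ENNReal.ofReal (inner ℝ x v ^ 2) := by
  set T : E ≃ₗᵢ[ℝ] E := (ℝ ∙ (u - v))ᗮ.reflection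
  have hT : T u = v := Submodule.reflection_sub h
  rw [← T.measurePreserving.lintegral_comp_emb T.toHomeomorph.measurableEmbedding
    (fun x ↦ φ ‖x‖ * ENNReal.ofReal (inner ℝ x v ^ 2))]
  simp [← hT]

/-- The second moment of a radial weight in a given direction. -/
lemma natCast_mul_lintegral_radial_mul_inner_sq {n : ℕ} {φ : ℝ → ℝ≥0∞}
    (hφ : Measurable φ) (u : EuclideanSpace ℝ (Fin n)) :
    (n : ℝ≥0∞) * ∫⁻ x : EuclideanSpace ℝ (Fin n), φ ‖x‖ * ENNReal.ofReal (inner ℝ x u ^ 2) =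
      ENNReal.ofReal (‖u‖ ^ 2) *
        ∫⁻ x : EuclideanSpace ℝ (Fin n), φ ‖x‖ * ENNReal.ofReal (‖x‖ ^ 2) := by
  have key (i : Fin n) :
      ∫⁻ x : EuclideanSpace ℝ (Fin n), φ ‖x‖ * ENNReal.ofReal (inner ℝ x u ^ 2) =
        ENNReal.ofReal (‖u‖ ^ 2) *
          ∫⁻ x : EuclideanSpace ℝ (Fin n), φ ‖x‖ * ENNReal.ofReal (x i ^ 2) := by
    rw [lintegral_radial_mul_inner_sq_congr φ (v := ‖u‖ • EuclideanSpace.single i (1 : ℝ))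
      (by simp [norm_smul]), ← lintegral_const_mul _ (by fun_prop)]
    refine lintegral_congr fun x ↦ ?_
    rw [inner_smul_right, EuclideanSpace.inner_single_right, mul_pow,
      ENNReal.ofReal_mul (by positivity)]
    simp only [one_mul, conj_trivial]
    ring
  calc _ = ∑ _i : Fin n, ∫⁻ x : EuclideanSpace ℝ (Fin n),
          φ ‖x‖ * ENNReal.ofReal (inner ℝ x u ^ 2) := by simp
    _ = ∑ i : Fin n, ENNReal.ofReal (‖u‖ ^ 2) *
          ∫⁻ x : EuclideanSpace ℝ (Fin n), φ ‖x‖ * ENNReal.ofReal (x i ^ 2) :=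
        Finset.sum_congr rfl fun i _ ↦ key i
    _ = _ := by
        rw [← Finset.mul_sum, ← lintegral_finsetSum _ (by fun_prop)]
        congr 1
        refine lintegral_congr fun x ↦ ?_
        rw [← Finset.mul_sum, ← ENNReal.ofReal_sum_of_nonneg (fun i _ ↦ sq_nonneg _),
          EuclideanSpace.real_norm_sq_eq]

/-- The tail integral of `‖x‖ ^ (-n - 1)`. -/
lemma lintegral_norm_gt_inv_norm_pow {n : ℕ} (hn : n ≠ 0) {R : ℝ} (hR : 0 < R) :
    ∫⁻ x in {x : EuclideanSpace ℝ (Fin n) | R < ‖x‖}, ENNReal.ofReal (1 / ‖x‖ ^ (n + 1)) =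
      ENNReal.ofReal
        (n * volume.real (ball (0 : EuclideanSpace ℝ (Fin n)) 1) / R) := by
  have : Nonempty (Fin n) := ⟨⟨0, Nat.pos_of_ne_zero hn⟩⟩
  set f : ℝ → ℝ := (Ioi R).indicator fun t ↦ 1 / t ^ (n + 1)
  have hS : MeasurableSet {x : EuclideanSpace ℝ (Fin n) | R < ‖x‖} :=
    measurableSet_lt (by fun_prop) (by fun_prop)
  have hf : ∀ y, y ^ (n - 1) • f y = (Ioi R).indicator (fun t ↦ t ^ (-2 : ℝ)) y := by
    intro y
    by_cases hy : y ∈ Ioi R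
    · have hy0 : 0 < y := hR.trans hy
      simp only [f, indicator_of_mem hy]
      rw [Real.rpow_neg hy0.le, show n + 1 = (n - 1) + 2 by lia, pow_add]
      simp only [smul_eq_mul, Real.rpow_ofNat]
      field_simp
    · simp [f, indicator_of_notMem hy]
  have hint : Integrable (fun x : EuclideanSpace ℝ (Fin n) ↦ f ‖x‖) := by
    rw [integrable_fun_norm_addHaar]
    simp only [finrank_euclideanSpace, Fintype.card_fin, hf]
    refine Integrable.integrableOn ?_
    rw [integrable_indicator_iff measurableSet_Ioi]
    exact integrableOn_Ioi_rpow_of_lt (by norm_num) hR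
  have hval : ∫ x : EuclideanSpace ℝ (Fin n), f ‖x‖ =
      n * volume.real (ball (0 : EuclideanSpace ℝ (Fin n)) 1) / R := by
    rw [integral_fun_norm_addHaar]
    simp only [finrank_euclideanSpace, Fintype.card_fin, hf]
    rw [setIntegral_indicator measurableSet_Ioi,
      inter_eq_right.2 (Ioi_subset_Ioi hR.le), integral_Ioi_rpow_of_lt (by norm_num) hR]
    norm_num [Real.rpow_neg_one]
    ring
  rw [← hval, ofReal_integral_eq_lintegral_ofReal hint
    (.of_forall fun x ↦ indicator_nonneg (fun t ht ↦ by
      have : 0 < t := hR.trans ht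
      positivity) _), ← lintegral_indicator hS]
  refine lintegral_congr fun x ↦ ?_
  by_cases hx : R < ‖x‖
  · simp [f, hx]
  · simp [f, hx]

lemma rieszConst_pos (n : ℕ) : 0 < rieszConst n := by
  unfold rieszConst
  have := Real.pi_pos
  have := Real.Gamma_pos_of_pos (s := ((n : ℝ) + 1) / 2) (by positivity)
  positivity

lemma rieszConst_mul_volume_ball_le_one {n : ℕ} (hn : 2 ≤ n) :
    rieszConst n * volume.real (ball (0 : EuclideanSpace ℝ (Fin n)) 1) ≤ 1 := by
  have : Nonempty (Fin n) := ⟨⟨0, by lia⟩⟩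
  have hn' : (2 : ℝ) ≤ n := by exact_mod_cast hn
  have hG : Real.Gamma (((n : ℝ) + 1) / 2) ≤ Real.Gamma ((n : ℝ) / 2 + 1) := by
    have h0 := Real.Gamma_pos_of_pos (s := (n : ℝ) / 2) (by positivity)
    have h1 := Real.Gamma_pos_of_pos (s := (n : ℝ) / 2 + 1) (by positivity)
    have hle : Real.Gamma ((n : ℝ) / 2) ≤ Real.Gamma ((n : ℝ) / 2 + 1) := by
      rw [Real.Gamma_add_one (by positivity)]
      nlinarith
    have := Real.Gamma_mul_add_mul_le_rpow_Gamma_mul_rpow_Gamma (s := (n : ℝ) / 2)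
      (t := (n : ℝ) / 2 + 1) (a := 1 / 2) (b := 1 / 2) (by positivity) (by positivity)
      (by norm_num) (by norm_num) (by norm_num)
    calc Real.Gamma (((n : ℝ) + 1) / 2)
        = Real.Gamma (1 / 2 * ((n : ℝ) / 2) + 1 / 2 * ((n : ℝ) / 2 + 1)) := by ring_nf
      _ ≤ _ := this
      _ ≤ Real.Gamma ((n : ℝ) / 2 + 1) ^ (1 / 2 : ℝ) *
          Real.Gamma ((n : ℝ) / 2 + 1) ^ (1 / 2 : ℝ) := by gcongr
      _ = _ := by rw [← Real.rpow_add h1]; norm_num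
  have h1 := Real.Gamma_pos_of_pos (s := (n : ℝ) / 2 + 1) (by positivity)
  have hpi : √Real.pi ^ n ≤ Real.pi ^ (((n : ℝ) + 1) / 2) := by
    rw [Real.sqrt_eq_rpow, ← Real.rpow_mul_natCast Real.pi_pos.le]
    exact Real.rpow_le_rpow_of_exponent_le (by linarith [Real.pi_gt_three]) (by linarith)
  have hp : 0 < Real.pi ^ (((n : ℝ) + 1) / 2) := Real.rpow_pos_of_pos Real.pi_pos _
  rw [measureReal_def, EuclideanSpace.volume_ball, rieszConst]
  simp only [ENNReal.ofReal_one, one_pow, one_mul, Fintype.card_fin]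
  rw [ENNReal.toReal_ofReal (by positivity), div_mul_div_comm, div_le_one (by positivity)]
  calc _ ≤ Real.Gamma ((n : ℝ) / 2 + 1) * Real.pi ^ (((n : ℝ) + 1) / 2) := by gcongr
    _ = _ := mul_comm _ _

/-- The derivative of the Riesz kernel along a line. -/
lemma hasDerivAt_rieszKernel_sub_smul {n : ℕ} (j : Fin n) (x w : EuclideanSpace ℝ (Fin n)) {t : ℝ}
    (h : x - t • w ≠ 0) :
    HasDerivAt (fun s : ℝ ↦ rieszKernel n j (x - s • w))
      (rieszConst n * ((n + 1) * ((x - t • w) j * inner ℝ (x - t • w) w) / ‖x - t • w‖ ^ (n + 3) -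
        w j / ‖x - t • w‖ ^ (n + 1))) t := by
  have h0 : 0 < ‖x - t • w‖ := norm_pos_iff.2 h
  have hv : HasDerivAt (fun s : ℝ ↦ x - s • w) (-w) t := by
    simpa using ((hasDerivAt_id t).smul_const w).const_sub x
  have hj : HasDerivAt (fun s : ℝ ↦ (x - s • w) j) (-w j) t := by
    simpa using ((hasDerivAt_id t).mul_const (w j)).const_sub (x j)
  have hN : HasDerivAt (fun s : ℝ ↦ ‖x - s • w‖)
      (-(inner ℝ (x - t • w) w / ‖x - t • w‖)) t := by
    have := hv.norm_sq.sqrt (by simpa using h0.ne')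
    simp only [Real.sqrt_sq (norm_nonneg _), inner_neg_right] at this
    convert this using 1
    field_simp
  have := (hj.const_mul (rieszConst n)).fun_div (hN.fun_pow (n + 1)) (by positivity)
  refine this.congr_deriv ?_
  simp only [Nat.add_sub_cancel, Nat.cast_add, Nat.cast_one]
  field_simp
  ring

/-- A majorant for the derivative of the Riesz kernel in the direction `w`, with `‖w‖ ≤ r`. -/
noncomputable def rieszMajorant (n : ℕ) (j : Fin n) (r : ℝ) (w x : EuclideanSpace ℝ (Fin n)) : ℝ :=
  rieszConst n * (r * (1 / ‖x‖ ^ (n + 1)) +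
    (n + 1) / 2 * (r * (1 / ‖x‖ ^ (n + 3) * inner ℝ x (EuclideanSpace.single j (1 : ℝ)) ^ 2) +
      r⁻¹ * (1 / ‖x‖ ^ (n + 3) * inner ℝ x w ^ 2)))

lemma abs_deriv_le_rieszMajorant {n : ℕ} (j : Fin n) {r : ℝ} (hr : 0 < r)
    {w : EuclideanSpace ℝ (Fin n)} (hw : ‖w‖ ≤ r) (x : EuclideanSpace ℝ (Fin n)) :
    |rieszConst n * ((n + 1) * (x j * inner ℝ x w) / ‖x‖ ^ (n + 3) - w j / ‖x‖ ^ (n + 1))| ≤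
      rieszMajorant n j r w x := by
  rw [abs_mul, abs_of_pos (rieszConst_pos n), rieszMajorant]
  refine mul_le_mul_of_nonneg_left ?_ (rieszConst_pos n).le
  have hwj : |w j| ≤ r := (PiLp.norm_apply_le w j).trans hw
  have hamgm : |x j * inner ℝ x w| ≤ (r * x j ^ 2 + r⁻¹ * inner ℝ x w ^ 2) / 2 := by
    rw [abs_le]
    have h1 : 0 ≤ r⁻¹ * (r * x j - inner ℝ x w) ^ 2 := by positivity
    have h2 : 0 ≤ r⁻¹ * (r * x j + inner ℝ x w) ^ 2 := by positivity
    have e1 : r⁻¹ * (r * x j - inner ℝ x w) ^ 2 =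
      r * x j ^ 2 + r⁻¹ * inner ℝ x w ^ 2 - 2 * (x j * inner ℝ x w) := by field_simp; ring
    have e2 : r⁻¹ * (r * x j + inner ℝ x w) ^ 2 =
      r * x j ^ 2 + r⁻¹ * inner ℝ x w ^ 2 + 2 * (x j * inner ℝ x w) := by field_simp; ring
    constructor <;> linarith
  refine (abs_sub _ _).trans ?_
  rw [abs_div, abs_div, abs_mul, abs_of_nonneg (by positivity : (0 : ℝ) ≤ n + 1),
    abs_of_nonneg (by positivity : 0 ≤ ‖x‖ ^ (n + 3)),
    abs_of_nonneg (by positivity : 0 ≤ ‖x‖ ^ (n + 1)), add_comm]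
  calc _ ≤ r / ‖x‖ ^ (n + 1) +
        (n + 1) * ((r * x j ^ 2 + r⁻¹ * inner ℝ x w ^ 2) / 2) / ‖x‖ ^ (n + 3) := by gcongr
    _ = _ := by
      rw [EuclideanSpace.inner_single_right]
      simp only [one_mul, conj_trivial]
      ring

lemma measurable_rieszKernel (n : ℕ) (j : Fin n) : Measurable (rieszKernel n j) := by
  unfold rieszKernel
  fun_prop

lemma measurable_rieszMajorant {n : ℕ} (j : Fin n) (r : ℝ) (w : EuclideanSpace ℝ (Fin n)) :
    Measurable (rieszMajorant n j r w) := by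
  unfold rieszMajorant
  fun_prop

lemma natCast_mul_lintegral_inv_norm_pow_mul_inner_sq {n : ℕ} {R : ℝ} (hR : 0 < R)
    (u : EuclideanSpace ℝ (Fin n)) :
    n * ∫⁻ x in {x : EuclideanSpace ℝ (Fin n) | R < ‖x‖},
        ENNReal.ofReal (1 / ‖x‖ ^ (n + 3) * inner ℝ x u ^ 2) =
      ENNReal.ofReal (‖u‖ ^ 2) * ∫⁻ x in {x : EuclideanSpace ℝ (Fin n) | R < ‖x‖},
        ENNReal.ofReal (1 / ‖x‖ ^ (n + 1)) := by
  set φ : ℝ → ℝ≥0∞ := (Ioi R).indicator fun t ↦ ENNReal.ofReal (1 / t ^ (n + 3))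
  have hφ : Measurable φ := Measurable.indicator (by fun_prop) measurableSet_Ioi
  have hS : MeasurableSet {x : EuclideanSpace ℝ (Fin n) | R < ‖x‖} :=
    measurableSet_lt (by fun_prop) (by fun_prop)
  have h := natCast_mul_lintegral_radial_mul_inner_sq hφ u
  rw [← lintegral_indicator hS, ← lintegral_indicator hS]
  calc _ = _ := by
        congr 1
        refine lintegral_congr fun x ↦ ?_
        by_cases hx : R < ‖x‖
        · simp only [φ, indicator, mem_ofPred_eq, mem_Ioi, hx, if_true]
          rw [ENNReal.ofReal_mul (by positivity)]
        · simp [φ, hx]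
    _ = _ := h
    _ = _ := by
        congr 1
        refine lintegral_congr fun x ↦ ?_
        by_cases hx : R < ‖x‖
        · have : 0 < ‖x‖ := hR.trans hx
          simp only [φ, indicator, mem_ofPred_eq, mem_Ioi, hx, if_true]
          rw [← ENNReal.ofReal_mul (by positivity)]
          congr 1
          field_simp
          ring
        · simp [φ, hx]

lemma lintegral_rieszMajorant_le {n : ℕ} (hn : 2 ≤ n) (j : Fin n) {r : ℝ} (hr : 0 < r)
    {w : EuclideanSpace ℝ (Fin n)} (hw : ‖w‖ ≤ r) :
    ∫⁻ x in {x : EuclideanSpace ℝ (Fin n) | n * r / 2 < ‖x‖},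
      ENNReal.ofReal (rieszMajorant n j r w x) ≤ 6 := by
  have hn' : (2 : ℝ) ≤ n := by exact_mod_cast hn
  have hn0 : (n : ℝ≥0∞) ≠ 0 := by simp; lia
  have hR : 0 < n * r / 2 := by positivity
  have hc := rieszConst_pos n
  have hV := rieszConst_mul_volume_ball_le_one hn
  set V := volume.real (ball (0 : EuclideanSpace ℝ (Fin n)) 1)
  have hI := lintegral_norm_gt_inv_norm_pow (n := n) (by lia) hR
  have hdir {u : EuclideanSpace ℝ (Fin n)} {ρ : ℝ} (hu : ‖u‖ ≤ ρ) :
      ∫⁻ x in {x : EuclideanSpace ℝ (Fin n) | n * r / 2 < ‖x‖},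
        ENNReal.ofReal (1 / ‖x‖ ^ (n + 3) * inner ℝ x u ^ 2) ≤
      ENNReal.ofReal (ρ ^ 2 * (2 * V / (n * r))) := by
    have h := natCast_mul_lintegral_inv_norm_pow_mul_inner_sq hR u
    rw [hI, ← ENNReal.ofReal_mul (by positivity)] at h
    rw [← ENNReal.mul_le_mul_iff_right hn0 (by simp), h, ← ENNReal.ofReal_natCast,
      ← ENNReal.ofReal_mul (by positivity)]
    refine ENNReal.ofReal_le_ofReal ?_
    calc _ ≤ ρ ^ 2 * (n * V / (n * r / 2)) := by gcongr
      _ = _ := by field_simp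
  have hsingle := hdir (u := EuclideanSpace.single j (1 : ℝ)) (ρ := 1) (by simp)
  have hwdir := hdir hw
  simp only [rieszMajorant]
  have hsplit {a b d : ℝ} (ha : 0 ≤ a) (hb : 0 ≤ b) (hd : 0 ≤ d) :
      ENNReal.ofReal (rieszConst n * (r * a + (n + 1) / 2 * (r * b + r⁻¹ * d))) =
      ENNReal.ofReal (rieszConst n) * (ENNReal.ofReal r * ENNReal.ofReal a +
        ENNReal.ofReal ((n + 1) / 2) * (ENNReal.ofReal r * ENNReal.ofReal b +
          ENNReal.ofReal r⁻¹ * ENNReal.ofReal d)) := by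
    rw [ENNReal.ofReal_mul hc.le, ENNReal.ofReal_add (by positivity) (by positivity),
      ENNReal.ofReal_mul hr.le, ENNReal.ofReal_mul (p := ((n : ℝ) + 1) / 2) (by positivity),
      ENNReal.ofReal_add (by positivity) (by positivity), ENNReal.ofReal_mul hr.le,
      ENNReal.ofReal_mul (p := r⁻¹) (by positivity)]
  rw [lintegral_congr fun x ↦ hsplit (by positivity) (by positivity) (by positivity)]
  rw [lintegral_const_mul _ (by fun_prop), lintegral_add_left (by fun_prop),
    lintegral_const_mul _ (by fun_prop), lintegral_const_mul _ (by fun_prop),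
    lintegral_add_left (by fun_prop), lintegral_const_mul _ (by fun_prop),
    lintegral_const_mul _ (by fun_prop), hI]
  calc _ ≤ ENNReal.ofReal (rieszConst n) * (ENNReal.ofReal r *
            ENNReal.ofReal (n * V / (n * r / 2)) +
        ENNReal.ofReal ((n + 1) / 2) * (ENNReal.ofReal r *
          ENNReal.ofReal (1 ^ 2 * (2 * V / (n * r))) +
          ENNReal.ofReal r⁻¹ * ENNReal.ofReal (r ^ 2 * (2 * V / (n * r))))) := by gcongr
    _ = ENNReal.ofReal (rieszConst n * (r * (n * V / (n * r / 2)) +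
        (n + 1) / 2 * (r * (1 ^ 2 * (2 * V / (n * r))) +
          r⁻¹ * (r ^ 2 * (2 * V / (n * r)))))) := by
      have hV0 : 0 ≤ V := measureReal_nonneg
      exact (hsplit (by positivity) (by positivity) (by positivity)).symm
    _ = ENNReal.ofReal (rieszConst n * V * (2 + 2 * ((n + 1) / n))) := by
      congr 1
      field_simp
      ring
    _ ≤ ENNReal.ofReal (1 * (2 + 2 * 2)) := by
      refine ENNReal.ofReal_le_ofReal ?_
      gcongr
      rw [div_le_iff₀ (by positivity)]
      linarith
    _ = 6 := by norm_num

/-- The Hörmander integral of the Riesz kernel is bounded independently of the dimension. -/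
lemma lintegral_enorm_rieszKernel_sub_le {n : ℕ} (hn : 2 ≤ n) (j : Fin n)
    (x₀ : EuclideanSpace ℝ (Fin n)) {r : ℝ} (hr : 0 < r) {z : EuclideanSpace ℝ (Fin n)}
    (hz : z ∈ closedBall x₀ r) :
    ∫⁻ y in {y : EuclideanSpace ℝ (Fin n) | n * r < ‖y - x₀‖},
      ‖rieszKernel n j (y - z) - rieszKernel n j (y - x₀)‖ₑ ≤ 6 := by
  have hn' : (2 : ℝ) ≤ n := by exact_mod_cast hn
  set w := z - x₀
  have hw : ‖w‖ ≤ r := by simpa [dist_eq_norm] using hz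
  set S := {y : EuclideanSpace ℝ (Fin n) | n * r < ‖y - x₀‖}
  have hS : MeasurableSet S := measurableSet_lt (by fun_prop) (by fun_prop)
  have hfar {y : EuclideanSpace ℝ (Fin n)} (hy : y ∈ S) {t : ℝ} (ht : t ∈ Icc (0 : ℝ) 1) :
      n * r / 2 < ‖y - x₀ - t • w‖ := by
    have h1 : ‖t • w‖ ≤ r := by
      rw [norm_smul, Real.norm_of_nonneg ht.1]
      nlinarith [ht.2, norm_nonneg w]
    have h2 := norm_sub_norm_le (y - x₀) (t • w)
    have h3 : n * r < ‖y - x₀‖ := hy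
    nlinarith
  have hpt {y : EuclideanSpace ℝ (Fin n)} (hy : y ∈ S) :
      ‖rieszKernel n j (y - z) - rieszKernel n j (y - x₀)‖ₑ ≤
        ∫⁻ t in Ioc (0 : ℝ) 1, ENNReal.ofReal (rieszMajorant n j r w (y - x₀ - t • w)) := by
    have hne {t : ℝ} (ht : t ∈ Icc (0 : ℝ) 1) : y - x₀ - t • w ≠ 0 :=
      norm_pos_iff.1 ((by positivity : (0 : ℝ) ≤ n * r / 2).trans_lt (hfar hy ht))
    set g : ℝ → ℝ := fun t ↦ rieszConst n * ((n + 1) * ((y - x₀ - t • w) j *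
      inner ℝ (y - x₀ - t • w) w) / ‖y - x₀ - t • w‖ ^ (n + 3) -
        w j / ‖y - x₀ - t • w‖ ^ (n + 1))
    have hcont : ContinuousOn g (uIcc 0 1) := by
      rw [uIcc_of_le zero_le_one]
      have hne' : ∀ t ∈ Icc (0 : ℝ) 1, ‖y - x₀ - t • w‖ ≠ 0 := fun t ht ↦
        norm_ne_zero_iff.2 (hne ht)
      refine continuousOn_const.mul (ContinuousOn.sub (ContinuousOn.div (by fun_prop)
        (by fun_prop) fun t ht ↦ pow_ne_zero _ (hne' t ht)) (ContinuousOn.div (by fun_prop)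
        (by fun_prop) fun t ht ↦ pow_ne_zero _ (hne' t ht)))
    have hftc := intervalIntegral.integral_eq_sub_of_hasDerivAt (a := 0) (b := 1)
      (f := fun t : ℝ ↦ rieszKernel n j (y - x₀ - t • w)) (f' := g)
      (fun t ht ↦ hasDerivAt_rieszKernel_sub_smul j (y - x₀) w
        (hne (by rwa [uIcc_of_le zero_le_one] at ht))) hcont.intervalIntegrable
    have hyz : y - x₀ - (1 : ℝ) • w = y - z := by simp [w]
    simp only [hyz, zero_smul, sub_zero] at hftc
    rw [← hftc, intervalIntegral.integral_of_le zero_le_one]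
    refine (enorm_integral_le_lintegral_enorm _).trans (lintegral_mono fun t ↦ ?_)
    rw [Real.enorm_eq_ofReal_abs]
    exact ENNReal.ofReal_le_ofReal (abs_deriv_le_rieszMajorant j hr hw _)
  have hmaj := measurable_rieszMajorant j r w
  calc _ ≤ ∫⁻ y in S, ∫⁻ t in Ioc (0 : ℝ) 1,
        ENNReal.ofReal (rieszMajorant n j r w (y - x₀ - t • w)) :=
        setLIntegral_mono' hS fun y hy ↦ hpt hy
    _ = ∫⁻ t in Ioc (0 : ℝ) 1, ∫⁻ y in S,
        ENNReal.ofReal (rieszMajorant n j r w (y - x₀ - t • w)) := by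
        refine lintegral_lintegral_swap (Measurable.aemeasurable ?_)
        refine (hmaj.comp ?_).ennreal_ofReal
        fun_prop
    _ ≤ ∫⁻ t in Ioc (0 : ℝ) 1, 6 := by
        refine setLIntegral_mono' measurableSet_Ioc fun t ht ↦ ?_
        refine le_trans ?_ (lintegral_rieszMajorant_le hn j hr hw)
        have hT : MeasurableSet {x : EuclideanSpace ℝ (Fin n) | n * r / 2 < ‖x‖} :=
          measurableSet_lt (by fun_prop) (by fun_prop)
        rw [← lintegral_indicator hT, ← lintegral_indicator hS,
          ← lintegral_sub_right_eq_self
            ({x : EuclideanSpace ℝ (Fin n) | n * r / 2 < ‖x‖}.indicator _) (x₀ + t • w)]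
        refine lintegral_mono (indicator_le fun y hy ↦ ?_)
        rw [← sub_sub, indicator_of_mem (mem_ofPred_eq ▸ hfar hy (Ioc_subset_Icc_self ht))]
    _ = 6 := by simp

lemma integrable_rieszKernel_sub {n : ℕ} (hn : 2 ≤ n) (j : Fin n)
    {x₀ : EuclideanSpace ℝ (Fin n)} {r : ℝ} (hr : 0 < r)
    (ν : Measure (EuclideanSpace ℝ (Fin n))) [IsFiniteMeasure ν]
    (hν : ∀ᵐ z ∂ν, z ∈ closedBall x₀ r) {y : EuclideanSpace ℝ (Fin n)}
    (hy : n * r < ‖y - x₀‖) :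
    Integrable (fun z ↦ rieszKernel n j (y - z)) ν := by
  have hn' : (2 : ℝ) ≤ n := by exact_mod_cast hn
  have hc := rieszConst_pos n
  refine Integrable.of_bound
    ((measurable_rieszKernel n j).comp (by fun_prop)).aestronglyMeasurable
    (rieszConst n / r ^ n) (hν.mono fun z hz ↦ ?_)
  have hz' : ‖z - x₀‖ ≤ r := by simpa [dist_eq_norm] using hz
  have h1 : r ≤ ‖y - z‖ := by
    have := norm_sub_norm_le (y - x₀) (z - x₀)
    rw [sub_sub_sub_cancel_right] at this
    nlinarith
  have h0 : 0 < ‖y - z‖ := hr.trans_le h1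
  rw [rieszKernel, norm_div, norm_mul, Real.norm_of_nonneg hc.le, norm_pow, norm_norm]
  calc _ ≤ rieszConst n * ‖y - z‖ / ‖y - z‖ ^ (n + 1) := by
        gcongr
        exact PiLp.norm_apply_le (y - z) j
    _ = rieszConst n / ‖y - z‖ ^ n := by
        rw [pow_succ]
        field_simp
    _ ≤ _ := by gcongr

lemma enorm_integral_sub_integral_le_of_measureReal_univ_eq {α : Type*} [MeasurableSpace α]
    {P N : Measure α} [IsFiniteMeasure P] [IsFiniteMeasure N] (h : P.real univ = N.real univ)
    {f : α → ℝ} (hP : Integrable f P) (hN : Integrable f N) (c : ℝ) :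
    ‖(∫ z, f z ∂P) - ∫ z, f z ∂N‖ₑ ≤ ∫⁻ z, ‖f z - c‖ₑ ∂(P + N) := by
  have e : (∫ z, f z ∂P) - ∫ z, f z ∂N = (∫ z, (f z - c) ∂P) - ∫ z, (f z - c) ∂N := by
    rw [integral_sub hP (integrable_const c), integral_sub hN (integrable_const c),
      integral_const, integral_const, h]
    ring
  rw [e, lintegral_add_measure]
  exact enorm_sub_le.trans (add_le_add (enorm_integral_le_lintegral_enorm _)
    (enorm_integral_le_lintegral_enorm _))

/-- Cancellation lemma with dimension-free constant: if `μ` is a finite signed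
Borel measure supported in `B(x₀,r)` with `μ(B(x₀,r)) = 0`, then
`∫_{|y-x₀| > nr} |Tμ(y)| dy ≤ C ‖μ‖`, where `Tμ(y) = ∫ K_j(y-z) dμ(z)`. -/
theorem riesz_cancellation_dimension_free :
    ∃ C : ℝ, 0 < C ∧
      ∀ (n : ℕ), 2 ≤ n → ∀ (j : Fin n),
      ∀ (x₀ : EuclideanSpace ℝ (Fin n)) (r : ℝ), 0 < r →
      ∀ μ : SignedMeasure (EuclideanSpace ℝ (Fin n)),
        (∀ s : Set (EuclideanSpace ℝ (Fin n)), MeasurableSet s →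
          s ⊆ (closedBall x₀ r)ᶜ → μ s = 0) →
        μ (closedBall x₀ r) = 0 →
        (∫⁻ y in {y : EuclideanSpace ℝ (Fin n) | (n : ℝ) * r < ‖y - x₀‖},
            ENNReal.ofReal
              |(∫ z, rieszKernel n j (y - z) ∂μ.toJordanDecomposition.posPart) -
                ∫ z, rieszKernel n j (y - z) ∂μ.toJordanDecomposition.negPart|) ≤
          ENNReal.ofReal C * μ.totalVariation univ := by
  refine ⟨6, by norm_num, fun n hn j x₀ r hr μ hsupp hzero ↦ ?_⟩
  set P := μ.toJordanDecomposition.posPart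
  set N := μ.toJordanDecomposition.negPart
  have hTV : μ.totalVariation = P + N := rfl
  have hae : ∀ᵐ z ∂(P + N), z ∈ closedBall x₀ r := by
    rw [← hTV, SignedMeasure.totalVariation_eq_variation]
    exact (VectorMeasure.variation_apply_eq_zero measurableSet_closedBall.compl).2
      fun s hs hm ↦ hsupp s hm hs
  have hmass : P.real univ = N.real univ := by
    have h1 : μ univ = P.real univ - N.real univ := by
      conv_lhs => rw [← μ.toSignedMeasure_toJordanDecomposition]
      rw [JordanDecomposition.toSignedMeasure, Measure.toSignedMeasure_sub_apply MeasurableSet.univ]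
    have h2 : μ univ = 0 := by
      rw [← union_compl_self (closedBall x₀ r), VectorMeasure.of_union disjoint_compl_right
        measurableSet_closedBall measurableSet_closedBall.compl, hzero,
        hsupp _ measurableSet_closedBall.compl subset_rfl, add_zero]
    linarith
  obtain ⟨haeP, haeN⟩ := ae_add_measure_iff.1 hae
  have hS : MeasurableSet {y : EuclideanSpace ℝ (Fin n) | n * r < ‖y - x₀‖} :=
    measurableSet_lt (by fun_prop) (by fun_prop)
  have hK := measurable_rieszKernel n j
  rw [hTV]
  calc _ ≤ ∫⁻ y in {y : EuclideanSpace ℝ (Fin n) | n * r < ‖y - x₀‖},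
        ∫⁻ z, ‖rieszKernel n j (y - z) - rieszKernel n j (y - x₀)‖ₑ ∂(P + N) := by
        refine setLIntegral_mono' hS fun y hy ↦ ?_
        rw [← Real.enorm_eq_ofReal_abs]
        exact enorm_integral_sub_integral_le_of_measureReal_univ_eq hmass
          (integrable_rieszKernel_sub hn j hr P haeP hy)
          (integrable_rieszKernel_sub hn j hr N haeN hy) _
    _ = ∫⁻ z, (∫⁻ y in {y : EuclideanSpace ℝ (Fin n) | n * r < ‖y - x₀‖},
        ‖rieszKernel n j (y - z) - rieszKernel n j (y - x₀)‖ₑ) ∂(P + N) := by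
        refine lintegral_lintegral_swap (Measurable.aemeasurable ?_)
        exact ((hK.comp (by fun_prop)).sub (hK.comp (by fun_prop))).enorm
    _ ≤ ∫⁻ _, 6 ∂(P + N) :=
        lintegral_mono_ae (hae.mono fun z hz ↦ lintegral_enorm_rieszKernel_sub_le hn j x₀ hr hz)
    _ = _ := by rw [lintegral_const]; norm_num
end

section
/- For every n ≥ 2, every j ∈ {1,…,n}, and every r > 0, one has ∫_{{x ∈ ℝⁿ : r < |x| < nr}} c_n |x_j|/|x|^{n+1} dx = (2/π) log(n), where c_n := Γ((n+1)/2)/π^{(n+1)/2}. -/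
open MeasureTheory Set

/-- Polar coordinates for the product of a function which is positively homogeneous of degree one
and a radial function. -/
theorem integral_homogeneous_mul_fun_norm {E : Type*} [NormedAddCommGroup E] [NormedSpace ℝ E]
    [FiniteDimensional ℝ E] [Nontrivial E] [MeasurableSpace E] [BorelSpace E]
    (μ : Measure E) [μ.IsAddHaarMeasure] {p : E → ℝ}
    (hp : ∀ t : ℝ, 0 < t → ∀ x, p (t • x) = t * p x) (f : ℝ → ℝ) :
    ∫ x, p x * f ‖x‖ ∂μ =
      (∫ θ : Metric.sphere (0 : E) 1, p θ ∂μ.toSphere) *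
        ∫ y in Ioi (0 : ℝ), y ^ Module.finrank ℝ E * f y :=
  calc
    ∫ x, p x * f ‖x‖ ∂μ = ∫ x : ({(0)}ᶜ : Set E), p x * f ‖x.1‖ ∂(μ.comap (↑)) := by
      rw [integral_subtype_comap (measurableSet_singleton _).compl fun x ↦ p x * f ‖x‖,
        restrict_compl_singleton]
    _ = ∫ x : ({(0)}ᶜ : Set E), p (‖x.1‖⁻¹ • x.1) * (‖x.1‖ * f ‖x.1‖) ∂(μ.comap (↑)) := by
      congr 1 with x
      have hx : 0 < ‖x.1‖ := norm_pos_iff.2 x.2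
      rw [hp _ (inv_pos.2 hx)]
      field_simp
    _ = ∫ z, p z.1 * (z.2 * f z.2)
          ∂μ.toSphere.prod (.volumeIoiPow (Module.finrank ℝ E - 1)) := by
      simpa using μ.measurePreserving_homeomorphUnitSphereProd.integral_comp
        (Homeomorph.measurableEmbedding _)
        (fun z : Metric.sphere (0 : E) 1 × Ioi (0 : ℝ) ↦ p z.1 * ((z.2 : ℝ) * f z.2))
    _ = (∫ θ : Metric.sphere (0 : E) 1, p θ ∂μ.toSphere) *
          ∫ y : Ioi (0 : ℝ), (y : ℝ) * f y ∂.volumeIoiPow (Module.finrank ℝ E - 1) :=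
      integral_prod_mul (fun θ : Metric.sphere (0 : E) 1 ↦ p θ)
        (fun y : Ioi (0 : ℝ) ↦ (y : ℝ) * f y)
    _ = _ := by
      congr 1
      simp only [Measure.volumeIoiPow, ENNReal.ofReal]
      rw [integral_withDensity_eq_integral_smul,
        integral_subtype_comap measurableSet_Ioi
          fun a ↦ Real.toNNReal (a ^ (Module.finrank ℝ E - 1)) • (a * f a),
        setIntegral_congr_fun measurableSet_Ioi fun x hx ↦ ?_]
      · rw [NNReal.smul_def, Real.coe_toNNReal _ (pow_nonneg hx.out.le _), smul_eq_mul,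
          ← mul_assoc, ← pow_succ, Nat.sub_add_cancel Module.finrank_pos]
      · exact (measurable_subtype_coe.pow_const _).real_toNNReal

theorem integral_Ioi_pow_mul_exp_neg_sq (n : ℕ) :
    ∫ y in Ioi (0 : ℝ), y ^ n * Real.exp (-y ^ 2) = Real.Gamma (((n : ℝ) + 1) / 2) / 2 := by
  have h := integral_rpow_mul_exp_neg_rpow (p := 2) (q := n) two_pos
    (by have := n.cast_nonneg (α := ℝ); linarith)
  simp only [Real.rpow_natCast, Real.rpow_ofNat] at h
  rw [h]
  ring

theorem integral_abs_mul_exp_neg_sq : ∫ t : ℝ, |t| * Real.exp (-t ^ 2) = 1 := by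
  have h := integral_comp_abs (f := fun t ↦ t * Real.exp (-t ^ 2))
  have h' := integral_Ioi_pow_mul_exp_neg_sq 1
  simp only [pow_one] at h'
  simp only [sq_abs] at h
  rw [h, h']
  norm_num

theorem integral_abs_coord_mul_exp_neg_norm_sq {n : ℕ} (j : Fin n) :
    ∫ x : EuclideanSpace ℝ (Fin n), |x j| * Real.exp (-‖x‖ ^ 2) =
      √Real.pi ^ (n - 1) := by
  rw [← (PiLp.volume_preserving_toLp (Fin n)).integral_comp
    (MeasurableEquiv.toLp 2 _).measurableEmbedding]
  have h (x : Fin n → ℝ) : |x j| * Real.exp (-‖WithLp.toLp 2 x‖ ^ 2) =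
      ∏ i, (if i = j then |x i| else 1) * Real.exp (-x i ^ 2) := by
    rw [Finset.prod_mul_distrib, ← Real.exp_sum, EuclideanSpace.real_norm_sq_eq]
    simp [Finset.sum_neg_distrib]
  have hg : ∫ t : ℝ, Real.exp (-t ^ 2) = √Real.pi := by simpa using integral_gaussian 1
  simp only [h]
  rw [integral_fintype_prod_volume_eq_prod
    (f := fun i (t : ℝ) ↦ (if i = j then |t| else 1) * Real.exp (-t ^ 2)),
    ← Finset.mul_prod_erase _ _ (Finset.mem_univ j)]
  rw [Finset.prod_congr rfl (g := fun _ ↦ √Real.pi)]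
  · simp [integral_abs_mul_exp_neg_sq]
  · intro i hi
    simp [Finset.ne_of_mem_erase hi, hg]

/-- The angular part of the Riesz kernel has `L¹` norm `2 / π`. -/
theorem rieszConst_mul_integral_sphere_abs_coord {n : ℕ} (j : Fin n) :
    rieszConst n * ∫ θ : Metric.sphere (0 : EuclideanSpace ℝ (Fin n)) 1,
      |(θ : EuclideanSpace ℝ (Fin n)) j| ∂(volume : Measure _).toSphere = 2 / Real.pi := by
  have : Nonempty (Fin n) := ⟨j⟩
  have h := integral_homogeneous_mul_fun_norm (volume : Measure (EuclideanSpace ℝ (Fin n)))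
    (p := fun x ↦ |x j|) (fun t ht x ↦ by simp [abs_mul, abs_of_pos ht])
    (fun y ↦ Real.exp (-y ^ 2))
  rw [integral_abs_coord_mul_exp_neg_norm_sq, finrank_euclideanSpace_fin,
    integral_Ioi_pow_mul_exp_neg_sq] at h
  have hpi : Real.pi ^ (((n : ℝ) + 1) / 2) = √Real.pi ^ (n - 1) * Real.pi := by
    rw [Real.rpow_div_two_eq_sqrt _ Real.pi_pos.le, ← Nat.cast_succ, Real.rpow_natCast]
    obtain ⟨m, rfl⟩ : ∃ m, n = m + 1 := Nat.exists_eq_add_one.2 j.pos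
    rw [Nat.add_sub_cancel, Nat.succ_eq_add_one, add_assoc, pow_add, one_add_one_eq_two,
      Real.sq_sqrt Real.pi_pos.le]
  rw [rieszConst, hpi, h]
  have hG : 0 < Real.Gamma (((n : ℝ) + 1) / 2) := Real.Gamma_pos_of_pos (by positivity)
  have hA : 0 < √Real.pi ^ (n - 1) := pow_pos (Real.sqrt_pos.2 Real.pi_pos) _
  rw [h] at hA
  have hA' := (pos_iff_pos_of_mul_pos hA).2 (by positivity)
  field_simp

/-- The integral of the absolute value of the Riesz kernel
`|K_j(x)| = c_n |x_j|/|x|^{n+1}` over the annulus `{r < |x| < nr}` equals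
`(2/π) log n`, in every dimension `n ≥ 2` and for every `r > 0`. -/
theorem riesz_kernel_annulus_integral (n : ℕ) (hn : 2 ≤ n) (j : Fin n)
    (r : ℝ) (hr : 0 < r) :
    (∫ x in {x : EuclideanSpace ℝ (Fin n) | r < ‖x‖ ∧ ‖x‖ < (n : ℝ) * r},
        rieszConst n * |x j| / ‖x‖ ^ (n + 1)) =
      (2 / Real.pi) * Real.log n := by
  have : Nonempty (Fin n) := ⟨j⟩
  have hn' : (1 : ℝ) ≤ n := by exact_mod_cast one_le_two.trans hn
  set f : ℝ → ℝ := (Ioo r (n * r)).indicator fun y ↦ (y ^ (n + 1))⁻¹ with hf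
  have hmeas : MeasurableSet {x : EuclideanSpace ℝ (Fin n) | r < ‖x‖ ∧ ‖x‖ < (n : ℝ) * r} :=
    measurable_norm measurableSet_Ioo
  have hpolar : (∫ x in {x : EuclideanSpace ℝ (Fin n) | r < ‖x‖ ∧ ‖x‖ < (n : ℝ) * r},
      rieszConst n * |x j| / ‖x‖ ^ (n + 1)) =
      rieszConst n * ∫ x : EuclideanSpace ℝ (Fin n), |x j| * f ‖x‖ := by
    rw [← integral_indicator hmeas, ← integral_const_mul]
    congr 1 with x
    by_cases hx : r < ‖x‖ ∧ ‖x‖ < (n : ℝ) * r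
    · rw [indicator_of_mem (by exact hx), hf, indicator_of_mem (by exact hx)]
      ring
    · rw [indicator_of_notMem (by exact hx), hf, indicator_of_notMem (by exact hx)]
      ring
  have hradial : ∫ y in Ioi (0 : ℝ), y ^ n * f y = Real.log n := by
    have hmul (y : ℝ) : y ^ n * f y = (Ioo r (n * r)).indicator (fun y ↦ y⁻¹) y := by
      rw [hf]
      by_cases hy : y ∈ Ioo r (n * r)
      · have : 0 < y := hr.trans hy.1
        simp only [indicator_of_mem hy]
        field_simp
        ring
      · simp only [indicator_of_notMem hy, mul_zero]
    simp only [hmul]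
    rw [setIntegral_indicator measurableSet_Ioo,
      inter_eq_self_of_subset_right (Ioo_subset_Ioi_self.trans (Ioi_subset_Ioi hr.le)),
      ← integral_Ioc_eq_integral_Ioo, ← intervalIntegral.integral_of_le (le_mul_of_one_le_left hr.le hn'),
      integral_inv_of_pos hr (by positivity), mul_div_cancel_right₀ _ hr.ne']
  rw [hpolar, integral_homogeneous_mul_fun_norm volume
    (p := fun x : EuclideanSpace ℝ (Fin n) ↦ |x j|) (fun t ht x ↦ by simp [abs_mul, abs_of_pos ht]),
    finrank_euclideanSpace_fin, hradial, ← mul_assoc, rieszConst_mul_integral_sphere_abs_coord]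
end
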